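/- arXiv:2207.10041 — 2 statements merged into one kernel-verified Lean document; each statement's English description precedes it below -/
import Mathlib

section
/- Let L be a stably continuous lattice, C a bicomplete regular category in which directed colimits commute with finite limits, and A an object of C. Then there is an equivalence of categories KShr_A(σFilt(L)^op, C) ≃ ΩShr_A(L, C) between the category of K-sheaf representations of A over σFilt(L)^op and the category of Ω-sheaf representations of A over L. -/
open CategoryTheory CategoryTheory.Limits Opposite

universe w v u

class RegularCat (C : Type u) [Category.{v} C] [HasFiniteLimits C] : Prop where
  factor : ∀ {X Y : C} (f : X ⟶ Y), ∃ (Z : C) (e : X ⟶ Z) (m : Z ⟶ Y),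
      Nonempty (RegularEpi e) ∧ Mono m ∧ e ≫ m = f
  stable : ∀ {X Y Z : C} (f : X ⟶ Y) (g : Z ⟶ Y),
      Nonempty (RegularEpi f) → Nonempty (RegularEpi (pullback.snd f g))

section OrderTheory

variable {L : Type w} [PartialOrder L]

/-- x is way below y: for every directed subset D admitting a supremum,
y ≤ sup D implies x ≤ d for some d ∈ D. -/
def WayBelow (x y : L) : Prop :=
  ∀ D : Set L, D.Nonempty → DirectedOn (· ≤ ·) D → ∀ s, IsLUB D s → y ≤ s → ∃ d ∈ D, x ≤ d

/-- ↡x = {y | y ≪ x}. -/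
def wb (x : L) : Set L := {y | WayBelow y x}

variable (L) in
/-- A dcpo: every (nonempty) directed subset has a supremum. -/
def IsDcpo : Prop :=
  ∀ D : Set L, D.Nonempty → DirectedOn (· ≤ ·) D → ∃ s, IsLUB D s

variable (L) in
/-- A domain: a dcpo in which every ↡x is directed with supremum x. -/
def IsDomainL : Prop :=
  IsDcpo L ∧ ∀ x : L, (wb x).Nonempty ∧ DirectedOn (· ≤ ·) (wb x) ∧ IsLUB (wb x) x

/-- A filter on L: a nonempty, upward-closed, codirected subset. -/
def IsFilterSet (k : Set L) : Prop :=
  k.Nonempty ∧ (∀ x ∈ k, ∀ y, x ≤ y → y ∈ k) ∧ DirectedOn (· ≥ ·) k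

/-- A Scott-open filter on L. -/
def IsScottOpenFilter (k : Set L) : Prop :=
  IsFilterSet k ∧
  ∀ D : Set L, D.Nonempty → DirectedOn (· ≤ ·) D → ∀ s, IsLUB D s → s ∈ k → (D ∩ k).Nonempty

variable (L) in
/-- σFilt(L): the poset of Scott-open filters on L, ordered by inclusion. -/
def SFilt : Type w := {k : Set L // IsScottOpenFilter k}

instance : PartialOrder (SFilt L) :=
  inferInstanceAs (PartialOrder {k : Set L // IsScottOpenFilter k})

end OrderTheory

section Functors

variable {C : Type u} [Category.{v} C] {J : Type w} [PartialOrder J]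

/-- The elementwise statement that the cocone (F(d) → F(s))_{d ∈ D} is a colimit of the
restriction of the (covariant) functor F to D. -/
def IsColimitOn (F : J ⥤ C) (D : Set J) (s : J) : Prop :=
  ∀ (B : C) (c : ∀ d ∈ D, F.obj d ⟶ B),
    (∀ d e (hd : d ∈ D) (he : e ∈ D) (h : d ≤ e), F.map (homOfLE h) ≫ c e he = c d hd) →
    ∃! u : F.obj s ⟶ B, ∀ d (hd : d ∈ D) (hds : d ≤ s), F.map (homOfLE hds) ≫ u = c d hd

/-- The elementwise statement that the cone (F(s) → F(d))_{d ∈ D} is a limit of the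
restriction of the presheaf F to D. -/
def IsLimitOn (F : Jᵒᵖ ⥤ C) (D : Set J) (s : J) : Prop :=
  ∀ (B : C) (c : ∀ d ∈ D, B ⟶ F.obj (op d)),
    (∀ d e (hd : d ∈ D) (he : e ∈ D) (h : d ≤ e), c e he ≫ F.map (homOfLE h).op = c d hd) →
    ∃! u : B ⟶ F.obj (op s), ∀ d (hd : d ∈ D) (hds : d ≤ s),
      u ≫ F.map (homOfLE hds).op = c d hd

end Functors

section Sheaves

variable {L : Type w} {C : Type u} [Category.{v} C]

/-- A C-valued K-sheaf on the complete lattice σFilt(L)^op, presented as a (covariant)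
functor G : σFilt(L) → C.  Joins/meets in σFilt(L)^op are meets/joins in σFilt(L), and
they are expressed via `IsGLB`/`IsLUB`; the top element of σFilt(L) is the bottom of
σFilt(L)^op. -/
def IsKSheafOnOp [PartialOrder L] [HasFiniteLimits C] (G : SFilt L ⥤ C) : Prop :=
  -- (K1): the value at ⊥ of σFilt(L)^op (= ⊤ of σFilt(L)) is subterminal
  (∀ t : SFilt L, IsTop t → Mono (terminal.from (G.obj t))) ∧
  -- (K2): all binary restriction squares are pullbacks
  (∀ (k l m j : SFilt L), IsGLB {k, l} m → IsLUB {k, l} j →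
    ∀ (hmk : m ≤ k) (hml : m ≤ l) (hkj : k ≤ j) (hlj : l ≤ j),
      IsPullback (G.map (homOfLE hmk)) (G.map (homOfLE hml))
        (G.map (homOfLE hkj)) (G.map (homOfLE hlj))) ∧
  -- (K3): codirected infima in σFilt(L)^op (= directed suprema in σFilt(L)) are sent
  -- to colimits
  (∀ D : Set (SFilt L), D.Nonempty → DirectedOn (· ≤ ·) D → ∀ s, IsLUB D s →
    IsColimitOn G D s)

/-- A C-valued Ω-sheaf on the complete lattice L. -/
def IsOmegaSheaf [CompleteLattice L] [HasFiniteLimits C] (F : Lᵒᵖ ⥤ C) : Prop :=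
  -- (Ω1): F(⊥) is subterminal
  Mono (terminal.from (F.obj (op (⊥ : L)))) ∧
  -- (Ω2): all binary restriction squares are pullbacks
  (∀ x y : L, IsPullback (F.map (homOfLE (le_sup_left : x ≤ x ⊔ y)).op)
    (F.map (homOfLE (le_sup_right : y ≤ x ⊔ y)).op)
    (F.map (homOfLE (inf_le_left : x ⊓ y ≤ x)).op)
    (F.map (homOfLE (inf_le_right : x ⊓ y ≤ y)).op)) ∧
  -- (Ω3): directed suprema are sent to limits
  (∀ D : Set L, D.Nonempty → DirectedOn (· ≤ ·) D → IsLimitOn F D (sSup D))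

end Sheaves

section RepCats

variable {L : Type w} {C : Type u} [Category.{v} C] [HasFiniteLimits C]

variable (C) in
/-- A K-sheaf representation of A over σFilt(L)^op: a K-sheaf G together with an
isomorphism φ : A → G(⊤_P), where the top element of P = σFilt(L)^op is the bottom
element b of σFilt(L). -/
structure KShrRepOp [PartialOrder L] (A : C) (b : SFilt L) : Type (max u v w) where
  G : SFilt L ⥤ C
  ksheaf : IsKSheafOnOp G
  φ : A ⟶ G.obj b
  iso : IsIso φ

instance [PartialOrder L] {A : C} {b : SFilt L} : Category (KShrRepOp C A b) where
  Hom X Y := {α : X.G ⟶ Y.G // X.φ ≫ α.app b = Y.φ}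
  id X := ⟨𝟙 X.G, by simp⟩
  comp f g := ⟨f.1 ≫ g.1, by rw [NatTrans.comp_app, ← Category.assoc, f.2, g.2]⟩
  id_comp f := Subtype.ext (by simp)
  comp_id f := Subtype.ext (by simp)
  assoc f g h := Subtype.ext (by simp)

variable (C) in
/-- An Ω-sheaf representation of A over L: an Ω-sheaf F together with an isomorphism
φ : A → F(⊤). -/
structure OmShrRep [CompleteLattice L] (A : C) : Type (max u v w) where
  F : Lᵒᵖ ⥤ C
  osheaf : IsOmegaSheaf F
  φ : A ⟶ F.obj (op (⊤ : L))
  iso : IsIso φ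

instance [CompleteLattice L] {A : C} : Category (OmShrRep C (L := L) A) where
  Hom X Y := {α : X.F ⟶ Y.F // X.φ ≫ α.app (op (⊤ : L)) = Y.φ}
  id X := ⟨𝟙 X.F, by simp⟩
  comp f g := ⟨f.1 ≫ g.1, by rw [NatTrans.comp_app, ← Category.assoc, f.2, g.2]⟩
  id_comp f := Subtype.ext (by simp)
  comp_id f := Subtype.ext (by simp)
  assoc f g h := Subtype.ext (by simp)

end RepCats

section Order

variable {L : Type w} [CompleteLattice L]

theorem WayBelow.le {x y : L} (h : WayBelow x y) : x ≤ y := by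
  obtain ⟨d, hd, hxd⟩ := h {y} ⟨y, rfl⟩ (directedOn_singleton y) y isLUB_singleton le_rfl
  exact hxd.trans (le_of_eq hd)

theorem WayBelow.mono {a x y b : L} (hax : a ≤ x) (h : WayBelow x y) (hyb : y ≤ b) :
    WayBelow a b := fun D hD hdir s hs hbs => by
  obtain ⟨d, hd, hxd⟩ := h D hD hdir s hs (hyb.trans hbs)
  exact ⟨d, hd, hax.trans hxd⟩

/-- `L` is a continuous lattice. -/
def IsContinuousLattice (L : Type w) [CompleteLattice L] : Prop :=
  ∀ x : L, (wb x).Nonempty ∧ DirectedOn (· ≤ ·) (wb x) ∧ IsLUB (wb x) x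

/-- The way-below relation on `L` is multiplicative, with compact top element. -/
def IsStable (L : Type w) [CompleteLattice L] : Prop :=
  WayBelow (⊤ : L) (⊤ : L) ∧
    ∀ x y z : L, WayBelow x y → WayBelow x z → WayBelow x (y ⊓ z)

theorem WayBelow.interpolate (hcont : IsContinuousLattice L) {w z : L} (h : WayBelow w z) :
    ∃ v, WayBelow w v ∧ WayBelow v z := by
  obtain ⟨v, ⟨u, hvu, huz⟩, hwv⟩ := h {v | ∃ u, WayBelow v u ∧ WayBelow u z}
    (by
      obtain ⟨u, hu⟩ := (hcont z).1
      obtain ⟨v, hv⟩ := (hcont u).1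
      exact ⟨v, u, hv, hu⟩)
    (by
      rintro v ⟨u, hvu, hu⟩ v' ⟨u', hvu', hu'⟩
      obtain ⟨u'', hu'', h1, h2⟩ := (hcont z).2.1 u hu u' hu'
      obtain ⟨v'', hv'', h3, h4⟩ := (hcont u'').2.1 v (hvu.mono le_rfl h1) v'
        (hvu'.mono le_rfl h2)
      exact ⟨v'', ⟨u'', hv'', hu''⟩, h3, h4⟩)
    z
    (by
      constructor
      · rintro v ⟨u, hvu, hu⟩
        exact hvu.le.trans hu.le
      · intro s hs
        refine (hcont z).2.2.2 fun u hu => (hcont u).2.2.2 fun v hv => hs ⟨u, hv, hu⟩)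
    le_rfl
  exact ⟨u, hvu.mono hwv le_rfl, huz⟩

namespace SFilt

theorem mem_of_le (k : SFilt L) {x y : L} (hx : x ∈ k.1) (h : x ≤ y) : y ∈ k.1 :=
  k.2.1.2.1 x hx y h

theorem top_mem (k : SFilt L) : (⊤ : L) ∈ k.1 := by
  obtain ⟨x, hx⟩ := k.2.1.1
  exact k.mem_of_le hx le_top

theorem inf_mem (k : SFilt L) {x y : L} (hx : x ∈ k.1) (hy : y ∈ k.1) : x ⊓ y ∈ k.1 := by
  obtain ⟨z, hz, h1, h2⟩ := k.2.1.2.2 x hx y hy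
  exact k.mem_of_le hz (le_inf h1 h2)

theorem exists_wayBelow (hcont : IsContinuousLattice L) (k : SFilt L) {x : L}
    (hx : x ∈ k.1) : ∃ w ∈ k.1, WayBelow w x := by
  obtain ⟨w, hw, hwk⟩ := k.2.2 (wb x) (hcont x).1 (hcont x).2.1 x (hcont x).2.2 hx
  exact ⟨w, hwk, hw⟩

/-- The Scott-open filter of all elements way above `w`. -/
def wayAbove (hcont : IsContinuousLattice L) (hstab : IsStable L) (w : L) : SFilt L :=
  ⟨{z | WayBelow w z},
    ⟨⟨⊤, hstab.1.mono le_top le_rfl⟩, fun _ hx _ h => hx.mono le_rfl h,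
      fun x hx y hy => ⟨x ⊓ y, hstab.2 _ _ _ hx hy, inf_le_left, inf_le_right⟩⟩, by
    intro D hD hdir s hs hws
    obtain ⟨v, hwv, hvs⟩ := WayBelow.interpolate hcont hws
    obtain ⟨d, hd, hvd⟩ := hvs D hD hdir s hs le_rfl
    exact ⟨d, hd, hwv.mono le_rfl hvd⟩⟩

theorem wayAbove_le {hcont : IsContinuousLattice L} {hstab : IsStable L} {w : L}
    {k : SFilt L} (hw : w ∈ k.1) : wayAbove hcont hstab w ≤ k :=
  fun _ hz => k.mem_of_le hw (WayBelow.le hz)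

/-- The intersection of two Scott-open filters. -/
def inter (k l : SFilt L) : SFilt L :=
  ⟨k.1 ∩ l.1,
    ⟨⟨⊤, k.top_mem, l.top_mem⟩, fun _ hx _ h => ⟨k.mem_of_le hx.1 h, l.mem_of_le hx.2 h⟩,
      fun x hx y hy => ⟨x ⊓ y, ⟨k.inf_mem hx.1 hy.1, l.inf_mem hx.2 hy.2⟩,
        inf_le_left, inf_le_right⟩⟩, by
    intro D hD hdir s hs hks
    obtain ⟨d, hd, hdk⟩ := k.2.2 D hD hdir s hs hks.1
    obtain ⟨e, he, hel⟩ := l.2.2 D hD hdir s hs hks.2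
    obtain ⟨f, hf, h1, h2⟩ := hdir d hd e he
    exact ⟨f, hf, k.mem_of_le hdk h1, l.mem_of_le hel h2⟩⟩

theorem inter_le_left (k l : SFilt L) : inter k l ≤ k := fun _ hx => hx.1

theorem inter_le_right (k l : SFilt L) : inter k l ≤ l := fun _ hx => hx.2

theorem le_inter {k l m : SFilt L} (hk : m ≤ k) (hl : m ≤ l) : m ≤ inter k l :=
  fun _ hx => ⟨hk hx, hl hx⟩

theorem isGLB_inter (k l : SFilt L) : IsGLB {k, l} (inter k l) := by
  constructor
  · rintro _ (rfl | rfl)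
    · exact inter_le_left _ _
    · exact inter_le_right _ _
  · intro m hm
    exact le_inter (hm (Or.inl rfl)) (hm (Or.inr rfl))

/-- The Scott-open filter generated by two Scott-open filters. -/
def join (hcont : IsContinuousLattice L) (hstab : IsStable L) (k l : SFilt L) : SFilt L :=
  ⟨{z | ∃ x ∈ k.1, ∃ y ∈ l.1, x ⊓ y ≤ z},
    ⟨⟨⊤, ⊤, k.top_mem, ⊤, l.top_mem, le_top⟩,
      fun _ ⟨x, hx, y, hy, hz⟩ _ h => ⟨x, hx, y, hy, hz.trans h⟩, by
      rintro z ⟨x, hx, y, hy, hz⟩ z' ⟨x', hx', y', hy', hz'⟩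
      exact ⟨z ⊓ z', ⟨x ⊓ x', k.inf_mem hx hx', y ⊓ y', l.inf_mem hy hy',
        by rw [inf_inf_inf_comm]; exact inf_le_inf hz hz'⟩, inf_le_left, inf_le_right⟩⟩, by
    rintro D hD hdir s hs ⟨x, hx, y, hy, hxy⟩
    obtain ⟨w, hw, hwx⟩ := k.exists_wayBelow hcont hx
    obtain ⟨v, hv, hvy⟩ := l.exists_wayBelow hcont hy
    obtain ⟨d, hd, hwd⟩ := hstab.2 (w ⊓ v) x y (hwx.mono inf_le_left le_rfl)
      (hvy.mono inf_le_right le_rfl) D hD hdir s hs hxy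
    exact ⟨d, hd, w, hw, v, hv, hwd⟩⟩

theorem isLUB_join (hcont : IsContinuousLattice L) (hstab : IsStable L) (k l : SFilt L) :
    IsLUB {k, l} (join hcont hstab k l) := by
  constructor
  · rintro _ (rfl | rfl)
    · exact fun x hx => ⟨x, hx, ⊤, l.top_mem, inf_le_left⟩
    · exact fun y hy => ⟨⊤, k.top_mem, y, hy, inf_le_right⟩
  · rintro m hm z ⟨x, hx, y, hy, hz⟩
    exact m.mem_of_le (m.inf_mem (hm (Or.inl rfl) hx) (hm (Or.inr rfl) hy)) hz

/-- A directed union of Scott-open filters. -/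
def directedUnion (D : Set (SFilt L)) (hD : D.Nonempty) (hdir : DirectedOn (· ≤ ·) D) :
    SFilt L :=
  ⟨{x | ∃ k ∈ D, x ∈ k.1},
    ⟨by obtain ⟨k, hk⟩ := hD; exact ⟨⊤, k, hk, k.top_mem⟩,
      fun _ ⟨k, hk, hx⟩ _ h => ⟨k, hk, k.mem_of_le hx h⟩, by
      rintro x ⟨k, hk, hx⟩ y ⟨l, hl, hy⟩
      obtain ⟨m, hm, h1, h2⟩ := hdir k hk l hl
      exact ⟨x ⊓ y, ⟨m, hm, m.inf_mem (h1 hx) (h2 hy)⟩, inf_le_left, inf_le_right⟩⟩, by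
    rintro E hE hEdir s hs ⟨k, hk, hx⟩
    obtain ⟨e, he, hek⟩ := k.2.2 E hE hEdir s hs hx
    exact ⟨e, he, k, hk, hek⟩⟩

theorem exists_mem_of_isLUB {D : Set (SFilt L)} (hD : D.Nonempty)
    (hdir : DirectedOn (· ≤ ·) D) {s : SFilt L} (hs : IsLUB D s) {x : L} (hx : x ∈ s.1) :
    ∃ k ∈ D, x ∈ k.1 := by
  have h : s ≤ directedUnion D hD hdir := hs.2 fun k hk x hx => ⟨k, hk, hx⟩
  exact h hx

variable (L) in
/-- The improper filter, the largest Scott-open filter. -/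
def whole : SFilt L :=
  ⟨Set.univ, ⟨⟨⊤, trivial⟩, fun _ _ _ _ => trivial,
    fun x _ y _ => ⟨x ⊓ y, trivial, inf_le_left, inf_le_right⟩⟩,
    fun _ hD _ _ _ _ => by simpa using hD⟩

end SFilt

end Order

section PairingSec

variable {L : Type w} [CompleteLattice L] {C : Type u} [Category.{v} C]

/-- A natural family of maps `F x ⟶ G k`, indexed by the pairs `x ∈ k`. -/
structure Pairing (F : Lᵒᵖ ⥤ C) (G : SFilt L ⥤ C) where
  t : ∀ (x : L) (k : SFilt L), x ∈ k.1 → (F.obj (op x) ⟶ G.obj k)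
  map_t : ∀ (x y : L) (k : SFilt L) (hx : x ∈ k.1) (hy : y ∈ k.1) (h : x ≤ y),
    F.map (homOfLE h).op ≫ t x k hx = t y k hy
  t_map : ∀ (x : L) (k l : SFilt L) (hk : x ∈ k.1) (hl : x ∈ l.1) (h : k ≤ l),
    t x k hk ≫ G.map (homOfLE h) = t x l hl

theorem isPullback_of_existsUnique {P X Y Z : C} {fst : P ⟶ X} {snd : P ⟶ Y} {f : X ⟶ Z}
    {g : Y ⟶ Z} (w : fst ≫ f = snd ≫ g)
    (h : ∀ (B : C) (a : B ⟶ X) (b : B ⟶ Y), a ≫ f = b ≫ g →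
      ∃! u : B ⟶ P, u ≫ fst = a ∧ u ≫ snd = b) : IsPullback fst snd f g := by
  choose u hu huniq using h
  exact ⟨⟨w⟩, ⟨PullbackCone.IsLimit.mk w (fun s => u _ s.fst s.snd s.condition)
    (fun s => (hu _ _ _ s.condition).1) (fun s => (hu _ _ _ s.condition).2)
    (fun s m h₁ h₂ => huniq _ _ _ s.condition m ⟨h₁, h₂⟩)⟩⟩

namespace Pairing

variable {F : Lᵒᵖ ⥤ C} {G : SFilt L ⥤ C}

theorem F_map_comp (F : Lᵒᵖ ⥤ C) {x y z : L} (h : x ≤ y) (h' : y ≤ z) :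
    F.map (homOfLE h').op ≫ F.map (homOfLE h).op = F.map (homOfLE (h.trans h')).op := by
  rw [← F.map_comp]; rfl

theorem G_map_comp {J : Type w} [PartialOrder J] (G : J ⥤ C) {x y z : J} (h : x ≤ y)
    (h' : y ≤ z) :
    G.map (homOfLE h) ≫ G.map (homOfLE h') = G.map (homOfLE (h.trans h')) := by
  rw [← G.map_comp]; rfl

/-- Each `F x` is the limit of the `G k` with `x ∈ k`. -/
def IsLim (p : Pairing F G) : Prop :=
  ∀ (x : L) (B : C) (c : ∀ k : SFilt L, x ∈ k.1 → (B ⟶ G.obj k)),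
    (∀ k l (hk : x ∈ k.1) (hl : x ∈ l.1) (h : k ≤ l), c k hk ≫ G.map (homOfLE h) = c l hl) →
    ∃! u : B ⟶ F.obj (op x), ∀ k hk, u ≫ p.t x k hk = c k hk

/-- Each `G k` is the colimit of the `F x` with `x ∈ k`. -/
def IsColim (p : Pairing F G) : Prop :=
  ∀ (k : SFilt L) (B : C) (c : ∀ x : L, x ∈ k.1 → (F.obj (op x) ⟶ B)),
    (∀ x y (hx : x ∈ k.1) (hy : y ∈ k.1) (h : x ≤ y), F.map (homOfLE h).op ≫ c x hx = c y hy) →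
    ∃! u : G.obj k ⟶ B, ∀ x hx, p.t x k hx ≫ u = c x hx

theorem IsLim.hom_ext {p : Pairing F G} (hp : p.IsLim) {x : L} {B : C}
    {u v : B ⟶ F.obj (op x)} (h : ∀ k hk, u ≫ p.t x k hk = v ≫ p.t x k hk) : u = v :=
  (hp x B (fun k hk => v ≫ p.t x k hk)
    (fun k l hk hl hkl => by rw [Category.assoc, p.t_map x k l hk hl hkl])).unique h
    (fun _ _ => rfl)

theorem IsColim.hom_ext {p : Pairing F G} (hp : p.IsColim) {k : SFilt L} {B : C}
    {u v : G.obj k ⟶ B} (h : ∀ x hx, p.t x k hx ≫ u = p.t x k hx ≫ v) : u = v :=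
  (hp k B (fun x hx => p.t x k hx ≫ v)
    (fun x y hx hy hxy => by rw [← Category.assoc, p.map_t x y k hx hy hxy])).unique h
    (fun _ _ => rfl)

theorem exists_isLim [HasLimitsOfSize.{w, w} C] (G : SFilt L ⥤ C) :
    ∃ (F : Lᵒᵖ ⥤ C) (p : Pairing F G), p.IsLim := by
  have key : ∀ x : L, ∃ (P : C) (π : ∀ k : SFilt L, x ∈ k.1 → (P ⟶ G.obj k)),
      (∀ k l hk hl (h : k ≤ l), π k hk ≫ G.map (homOfLE h) = π l hl) ∧
      ∀ (B : C) (c : ∀ k : SFilt L, x ∈ k.1 → (B ⟶ G.obj k)),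
        (∀ k l hk hl (h : k ≤ l), c k hk ≫ G.map (homOfLE h) = c l hl) →
        ∃! u : B ⟶ P, ∀ k hk, u ≫ π k hk = c k hk := by
    intro x
    let ι : {k : SFilt L // x ∈ k.1} ⥤ C :=
      Monotone.functor (f := Subtype.val) (fun _ _ h => h) ⋙ G
    refine ⟨limit ι, fun k hk => limit.π ι ⟨k, hk⟩, fun k l hk hl h =>
      limit.w ι (j := ⟨k, hk⟩) (j' := ⟨l, hl⟩) (homOfLE h), fun B c hc => ?_⟩
    refine ⟨limit.lift ι ⟨B, fun k => c k.1 k.2, fun k l f =>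
      (Category.id_comp _).trans (hc k.1 l.1 k.2 l.2 (leOfHom f)).symm⟩,
      fun k hk => limit.lift_π _ _, fun u hu => limit.hom_ext fun k => ?_⟩
    rw [limit.lift_π]
    exact hu k.1 k.2
  choose P π hπ hP using key
  have hext : ∀ (x : L) (B : C) (u v : B ⟶ P x),
      (∀ k hk, u ≫ π x k hk = v ≫ π x k hk) → u = v := fun x B u v h =>
    (hP x B (fun k hk => v ≫ π x k hk)
      (fun k l hk hl hkl => by rw [Category.assoc, hπ x k l hk hl hkl])).unique h fun _ _ => rfl
  have hres : ∀ x y : L, x ≤ y → ∃ r : P y ⟶ P x, ∀ k hx hy, r ≫ π x k hx = π y k hy := by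
    intro x y h
    obtain ⟨r, hr, -⟩ := hP x (P y) (fun k hk => π y k (k.mem_of_le hk h))
      (fun k l hk hl hkl => hπ y k l _ _ hkl)
    exact ⟨r, fun k hx _ => hr k hx⟩
  choose r hr using hres
  refine ⟨{ obj := fun x => P x.unop
            map := fun f => r _ _ (leOfHom f.unop)
            map_id := fun x => hext _ _ _ _ fun k hk => by
              rw [hr _ _ _ k hk hk, Category.id_comp]
            map_comp := fun {x y z} f g => hext _ _ _ _ fun k hk => by
              have hy := k.mem_of_le hk (leOfHom g.unop)
              have hx := k.mem_of_le hy (leOfHom f.unop)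
              rw [Category.assoc, hr _ _ _ k hk hx, hr _ _ _ k hk hy, hr _ _ _ k hy hx] },
    ⟨π, fun x y k hx hy h => hr x y h k hx hy, hπ⟩, hP⟩

theorem exists_isColim [HasColimitsOfSize.{w, w} C] (F : Lᵒᵖ ⥤ C) :
    ∃ (G : SFilt L ⥤ C) (p : Pairing F G), p.IsColim := by
  have key : ∀ k : SFilt L, ∃ (P : C) (i : ∀ x : L, x ∈ k.1 → (F.obj (op x) ⟶ P)),
      (∀ x y hx hy (h : x ≤ y), F.map (homOfLE h).op ≫ i x hx = i y hy) ∧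
      ∀ (B : C) (c : ∀ x : L, x ∈ k.1 → (F.obj (op x) ⟶ B)),
        (∀ x y hx hy (h : x ≤ y), F.map (homOfLE h).op ≫ c x hx = c y hy) →
        ∃! u : P ⟶ B, ∀ x hx, i x hx ≫ u = c x hx := by
    intro k
    let ι : {x : L // x ∈ k.1}ᵒᵖ ⥤ C :=
      (Monotone.functor (f := Subtype.val) (fun _ _ h => h)).op ⋙ F
    refine ⟨colimit ι, fun x hx => colimit.ι ι (op ⟨x, hx⟩), fun x y hx hy h =>
      colimit.w ι
        (Quiver.Hom.op (X := (⟨x, hx⟩ : {x : L // x ∈ k.1})) (Y := ⟨y, hy⟩) (homOfLE h)),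
      fun B c hc => ?_⟩
    refine ⟨colimit.desc ι ⟨B, fun x => c x.unop.1 x.unop.2, fun x y f =>
      (hc y.unop.1 x.unop.1 y.unop.2 x.unop.2 (leOfHom f.unop)).trans (Category.comp_id _).symm⟩,
      fun x hx => colimit.ι_desc _ _, fun u hu => colimit.hom_ext fun x => ?_⟩
    rw [colimit.ι_desc]
    exact hu x.unop.1 x.unop.2
  choose P i hi hP using key
  have hext : ∀ (k : SFilt L) (B : C) (u v : P k ⟶ B),
      (∀ x hx, i k x hx ≫ u = i k x hx ≫ v) → u = v := fun k B u v h =>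
    (hP k B (fun x hx => i k x hx ≫ v)
      (fun x y hx hy hxy => by rw [← Category.assoc, hi k x y hx hy hxy])).unique h fun _ _ => rfl
  have hres : ∀ k l : SFilt L, k ≤ l → ∃ r : P k ⟶ P l, ∀ x hk hl, i k x hk ≫ r = i l x hl := by
    intro k l h
    obtain ⟨r, hr, -⟩ := hP k (P l) (fun x hx => i l x (h hx))
      (fun x y hx hy hxy => hi l x y _ _ hxy)
    exact ⟨r, fun x hk _ => hr x hk⟩
  choose r hr using hres
  refine ⟨{ obj := P
            map := fun f => r _ _ (leOfHom f)
            map_id := fun k => hext _ _ _ _ fun x hx => by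
              rw [hr _ _ _ x hx hx, Category.comp_id]
            map_comp := fun {k l m} f g => hext _ _ _ _ fun x hx => by
              have hl := leOfHom f hx
              have hm := leOfHom g hl
              rw [← Category.assoc, hr _ _ _ x hx hm, hr _ _ _ x hx hl, hr _ _ _ x hl hm] },
    ⟨fun x k hk => i k x hk, fun x y k hx hy h => hi k x y hx hy h,
      fun x k l hk hl h => hr k l h x hk hl⟩, hP⟩

theorem IsLim.isColim (hcont : IsContinuousLattice L) (hstab : IsStable L)
    {p : Pairing F G} (hp : p.IsLim)
    (hG : ∀ D : Set (SFilt L), D.Nonempty → DirectedOn (· ≤ ·) D → ∀ s, IsLUB D s →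
      IsColimitOn G D s) : p.IsColim := by
  intro k B c hc
  have key : ∀ (l : SFilt L) (w : L), (∀ z ∈ l.1, w ≤ z) → ∃ r : G.obj l ⟶ F.obj (op w),
      ∀ m (hm : w ∈ m.1) (h : l ≤ m), r ≫ p.t w m hm = G.map (homOfLE h) := by
    intro l w hw
    obtain ⟨r, hr, -⟩ := hp w (G.obj l)
      (fun m hm => G.map (homOfLE (fun z hz => m.mem_of_le hm (hw z hz) : l ≤ m)))
      (fun m n _ _ h => G_map_comp G _ _)
    exact ⟨r, fun m hm h => hr m hm⟩
  choose r hr using key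
  have hrF : ∀ l w (hw : ∀ z ∈ l.1, w ≤ z) w' (hw' : ∀ z ∈ l.1, w' ≤ z) (h : w ≤ w'),
      r l w' hw' ≫ F.map (homOfLE h).op = r l w hw := by
    intro l w hw w' hw' h
    refine hp.hom_ext fun m hm => ?_
    rw [Category.assoc, p.map_t w w' m hm (m.mem_of_le hm h) h,
      hr l w' hw' m _ (fun z hz => m.mem_of_le hm (hw z hz)),
      hr l w hw m _ (fun z hz => m.mem_of_le hm (hw z hz))]
  have hrG : ∀ l l' w (hw : ∀ z ∈ l.1, w ≤ z) (hw' : ∀ z ∈ l'.1, w ≤ z) (h : l ≤ l'),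
      G.map (homOfLE h) ≫ r l' w hw' = r l w hw := by
    intro l l' w hw hw' h
    refine hp.hom_ext fun m hm => ?_
    rw [Category.assoc, hr l' w hw' m _ (fun z hz => m.mem_of_le hm (hw' z hz)),
      hr l w hw m _ (fun z hz => m.mem_of_le hm (hw z hz))]
    exact G_map_comp G _ _
  have hindep : ∀ l w (hw : ∀ z ∈ l.1, w ≤ z) w' (hw' : ∀ z ∈ l.1, w' ≤ z)
      (hk : w ∈ k.1) (hk' : w' ∈ k.1), r l w hw ≫ c w hk = r l w' hw' ≫ c w' hk' := by
    intro l w hw w' hw' hk hk'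
    have hi : ∀ z ∈ l.1, w ⊓ w' ≤ z := fun z hz => inf_le_left.trans (hw z hz)
    have hik := k.inf_mem hk hk'
    rw [← hc _ _ hik hk inf_le_left, ← hc _ _ hik hk' inf_le_right, ← Category.assoc,
      ← Category.assoc, hrF l _ hi, hrF l _ hi]
  let D : Set (SFilt L) := {l | ∃ w ∈ k.1, ∀ z ∈ l.1, w ≤ z}
  have hmemD : ∀ w ∈ k.1, SFilt.wayAbove hcont hstab w ∈ D := fun w hw =>
    ⟨w, hw, fun z hz => WayBelow.le hz⟩
  have hDle : ∀ l ∈ D, l ≤ k := fun l ⟨w, hw, h⟩ z hz => k.mem_of_le hw (h z hz)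
  have hDne : D.Nonempty := ⟨_, hmemD ⊤ k.top_mem⟩
  have hDdir : DirectedOn (· ≤ ·) D := by
    rintro l ⟨w, hw, h⟩ l' ⟨w', hw', h'⟩
    obtain ⟨v, hv, hvw⟩ := k.exists_wayBelow hcont (k.inf_mem hw hw')
    refine ⟨_, hmemD v hv, fun z hz => ?_, fun z hz => ?_⟩
    · exact hvw.mono le_rfl (inf_le_left.trans (h z hz))
    · exact hvw.mono le_rfl (inf_le_right.trans (h' z hz))
  have hDk : IsLUB D k := by
    refine ⟨fun l hl => hDle l hl, fun m hm x hx => ?_⟩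
    obtain ⟨w, hw, hwx⟩ := k.exists_wayBelow hcont hx
    exact hm (hmemD w hw) hwx
  choose wl hwl hwl' using fun (l : SFilt L) (hl : l ∈ D) => hl
  obtain ⟨u, hu, huniq⟩ := hG D hDne hDdir k hDk B
    (fun l hl => r l (wl l hl) (hwl' l hl) ≫ c _ (hwl l hl)) (by
      intro l l' hl hl' h
      rw [← Category.assoc, hrG l l' _ (fun z hz => hwl' l' hl' z (h hz)) _ h]
      exact hindep _ _ _ _ _ _ _)
  refine ⟨u, fun x hx => ?_, fun u' hu' => huniq u' fun l hl hlk => ?_⟩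
  · obtain ⟨w, hw, hwx⟩ := k.exists_wayBelow hcont hx
    have hle : SFilt.wayAbove hcont hstab w ≤ k := SFilt.wayAbove_le hw
    have hxw : x ∈ (SFilt.wayAbove hcont hstab w).1 := hwx
    have hb : ∀ z ∈ (SFilt.wayAbove hcont hstab w).1, w ≤ z := fun z hz => WayBelow.le hz
    rw [← p.t_map x _ k hxw hx hle, Category.assoc, hu _ (hmemD w hw) hle,
      hindep _ _ _ w hb _ hw, ← Category.assoc]
    have : p.t x _ hxw ≫ r _ w hb = F.map (homOfLE hwx.le).op := by
      refine hp.hom_ext fun m hm => ?_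
      rw [Category.assoc, hr _ w hb m hm (SFilt.wayAbove_le hm),
        p.t_map x _ m _ (m.mem_of_le hm hwx.le), p.map_t w x m hm (m.mem_of_le hm hwx.le)]
    rw [this, hc _ _ _ hx]
  · rw [← hu' _ (hwl l hl), ← Category.assoc, hr _ _ _ k _ hlk]

theorem IsColim.isLim (hcont : IsContinuousLattice L) (hstab : IsStable L)
    {p : Pairing F G} (hp : p.IsColim)
    (hF : ∀ D : Set L, D.Nonempty → DirectedOn (· ≤ ·) D → IsLimitOn F D (sSup D)) :
    p.IsLim := by
  intro x B c hc
  let W : L → SFilt L := SFilt.wayAbove hcont hstab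
  have key : ∀ w : L, ∃ r : G.obj (W w) ⟶ F.obj (op w),
      ∀ z (hz : z ∈ (W w).1) (h : w ≤ z), p.t z _ hz ≫ r = F.map (homOfLE h).op := by
    intro w
    obtain ⟨r, hr, -⟩ := hp (W w) (F.obj (op w)) (fun z hz => F.map (homOfLE (WayBelow.le hz)).op)
      (fun _ _ _ _ _ => F_map_comp F _ _)
    exact ⟨r, fun z hz _ => hr z hz⟩
  choose r hr using key
  have hrt : ∀ w k (hw : w ∈ k.1) (h : W w ≤ k), r w ≫ p.t w k hw = G.map (homOfLE h) := by
    intro w k hw h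
    refine hp.hom_ext fun z hz => ?_
    rw [← Category.assoc, hr w z hz (WayBelow.le hz), p.map_t w z k hw (h hz),
      p.t_map z _ k hz (h hz)]
  have hrF : ∀ w w' (h : w ≤ w') (h' : W w' ≤ W w),
      r w' ≫ F.map (homOfLE h).op = G.map (homOfLE h') ≫ r w := by
    intro w w' h h'
    refine hp.hom_ext fun z hz => ?_
    rw [← Category.assoc, ← Category.assoc, hr w' z hz (WayBelow.le hz), F_map_comp,
      p.t_map z _ _ hz (h' hz), hr w z]
  have hlim : IsLimitOn F (wb x) x := by
    have := hF (wb x) (hcont x).1 (hcont x).2.1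
    rwa [(hcont x).2.2.sSup_eq] at this
  obtain ⟨u, hu, huniq⟩ := hlim B (fun w hw => c (W w) hw ≫ r w) (by
    intro w w' hw hw' h
    have h' : W w' ≤ W w := fun z hz => WayBelow.mono h hz le_rfl
    have hw₁ : x ∈ (W w).1 := hw
    have hw₂ : x ∈ (W w').1 := hw'
    rw [Category.assoc, hrF w w' h h', ← Category.assoc, hc _ _ hw₂ hw₁])
  refine ⟨u, fun k hk => ?_, fun u' hu' => huniq u' fun w hw hwx => ?_⟩
  · obtain ⟨w, hw, hwx⟩ := k.exists_wayBelow hcont hk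
    rw [← p.map_t w x k hw hk hwx.le, ← Category.assoc, hu w hwx hwx.le, Category.assoc,
      hrt w k hw (SFilt.wayAbove_le hw)]
    exact hc _ _ _ hk _
  · rw [← hu' (W w) hw, Category.assoc, hr w x hw hwx]

theorem IsLim.isLimitOn {p : Pairing F G} (hp : p.IsLim) (D : Set L) (hD : D.Nonempty)
    (hdir : DirectedOn (· ≤ ·) D) : IsLimitOn F D (sSup D) := by
  intro B c hc
  have hindep : ∀ (k : SFilt L) d e (hd : d ∈ D) (he : e ∈ D) (hdk : d ∈ k.1) (hek : e ∈ k.1),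
      c d hd ≫ p.t d k hdk = c e he ≫ p.t e k hek := by
    intro k d e hd he hdk hek
    obtain ⟨f, hf, h1, h2⟩ := hdir d hd e he
    rw [← hc d f hd hf h1, ← hc e f he hf h2, Category.assoc, Category.assoc,
      p.map_t d f k _ (k.mem_of_le hdk h1), p.map_t e f k _ (k.mem_of_le hdk h1)]
  choose d hd hdk using fun (k : SFilt L) (hk : sSup D ∈ k.1) =>
    k.2.2 D hD hdir (sSup D) (isLUB_sSup D) hk
  obtain ⟨u, hu, huniq⟩ := hp (sSup D) B (fun k hk => c _ (hd k hk) ≫ p.t _ k (hdk k hk)) (by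
    intro k l hk hl h
    rw [Category.assoc, p.t_map _ k l _ (h (hdk k hk))]
    exact hindep _ _ _ _ _ _ _)
  refine ⟨u, fun e he hes => hp.hom_ext fun k hk => ?_, fun u' hu' => huniq u' fun k hk => ?_⟩
  · rw [Category.assoc, p.map_t e _ k hk (k.mem_of_le hk hes), hu]
    exact hindep _ _ _ _ _ _ _
  · rw [← hu' _ (hd k hk) (le_sSup (hd k hk)), Category.assoc, p.map_t _ _ k (hdk k hk) hk]

theorem IsColim.isColimitOn {p : Pairing F G} (hp : p.IsColim) (D : Set (SFilt L))
    (hD : D.Nonempty) (hdir : DirectedOn (· ≤ ·) D) (s : SFilt L) (hs : IsLUB D s) :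
    IsColimitOn G D s := by
  intro B c hc
  have hindep : ∀ (x : L) k l (hk : k ∈ D) (hl : l ∈ D) (hxk : x ∈ k.1) (hxl : x ∈ l.1),
      p.t x k hxk ≫ c k hk = p.t x l hxl ≫ c l hl := by
    intro x k l hk hl hxk hxl
    obtain ⟨m, hm, h1, h2⟩ := hdir k hk l hl
    rw [← hc k m hk hm h1, ← hc l m hl hm h2, ← Category.assoc, ← Category.assoc,
      p.t_map x k m _ (h1 hxk), p.t_map x l m _ (h1 hxk)]
  choose d hd hdk using fun (x : L) (hx : x ∈ s.1) => SFilt.exists_mem_of_isLUB hD hdir hs hx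
  obtain ⟨u, hu, huniq⟩ := hp s B (fun x hx => p.t x _ (hdk x hx) ≫ c _ (hd x hx)) (by
    intro x y hx hy h
    rw [← Category.assoc, p.map_t x y _ _ (SFilt.mem_of_le _ (hdk x hx) h)]
    exact hindep _ _ _ _ _ _ _)
  refine ⟨u, fun k hk hks => hp.hom_ext fun x hx => ?_, fun u' hu' => huniq u' fun x hx => ?_⟩
  · rw [← Category.assoc, p.t_map x k s hx (hks hx), hu]
    exact hindep _ _ _ _ _ _ _
  · rw [← hu' _ (hd x hx) (hs.1 (hd x hx)), ← Category.assoc, p.t_map x _ s (hdk x hx) hx]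

theorem IsLim.isPullback (hcont : IsContinuousLattice L) (hstab : IsStable L)
    {p : Pairing F G} (hp : p.IsLim)
    (hG : ∀ (k l m j : SFilt L), IsGLB {k, l} m → IsLUB {k, l} j →
      ∀ (hmk : m ≤ k) (hml : m ≤ l) (hkj : k ≤ j) (hlj : l ≤ j),
        IsPullback (G.map (homOfLE hmk)) (G.map (homOfLE hml))
          (G.map (homOfLE hkj)) (G.map (homOfLE hlj))) (x y : L) :
    IsPullback (F.map (homOfLE (le_sup_left : x ≤ x ⊔ y)).op)
      (F.map (homOfLE (le_sup_right : y ≤ x ⊔ y)).op)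
      (F.map (homOfLE (inf_le_left : x ⊓ y ≤ x)).op)
      (F.map (homOfLE (inf_le_right : x ⊓ y ≤ y)).op) := by
  have hPB : ∀ k l : SFilt L, IsPullback (G.map (homOfLE (SFilt.inter_le_left k l)))
      (G.map (homOfLE (SFilt.inter_le_right k l)))
      (G.map (homOfLE ((SFilt.isLUB_join hcont hstab k l).1 (Or.inl rfl))))
      (G.map (homOfLE ((SFilt.isLUB_join hcont hstab k l).1 (Or.inr rfl)))) := fun k l =>
    hG k l _ _ (SFilt.isGLB_inter k l) (SFilt.isLUB_join hcont hstab k l) _ _ _ _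
  have hsub : ∀ m : SFilt L, x ⊔ y ∈ m.1 → ∃ k l : SFilt L, x ∈ k.1 ∧ y ∈ l.1 ∧
      SFilt.inter k l ≤ m := by
    intro m hm
    obtain ⟨d, ⟨w, hw, v, hv, rfl⟩, hd⟩ := m.2.2 {d | ∃ w ∈ wb x, ∃ v ∈ wb y, d = w ⊔ v}
      (by
        obtain ⟨w, hw⟩ := (hcont x).1
        obtain ⟨v, hv⟩ := (hcont y).1
        exact ⟨_, w, hw, v, hv, rfl⟩)
      (by
        rintro _ ⟨w, hw, v, hv, rfl⟩ _ ⟨w', hw', v', hv', rfl⟩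
        obtain ⟨w'', hw'', h1, h2⟩ := (hcont x).2.1 w hw w' hw'
        obtain ⟨v'', hv'', h3, h4⟩ := (hcont y).2.1 v hv v' hv'
        exact ⟨_, ⟨w'', hw'', v'', hv'', rfl⟩, sup_le_sup h1 h3, sup_le_sup h2 h4⟩)
      (x ⊔ y)
      (by
        constructor
        · rintro _ ⟨w, hw, v, hv, rfl⟩
          exact sup_le_sup (WayBelow.le hw) (WayBelow.le hv)
        · intro s hs
          obtain ⟨w, hw⟩ := (hcont x).1
          obtain ⟨v, hv⟩ := (hcont y).1
          exact sup_le
            ((hcont x).2.2.2 fun w' hw' => le_sup_left.trans (hs ⟨w', hw', v, hv, rfl⟩))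
            ((hcont y).2.2.2 fun v' hv' => le_sup_right.trans (hs ⟨w, hw, v', hv', rfl⟩)))
      hm
    exact ⟨SFilt.wayAbove hcont hstab w, SFilt.wayAbove hcont hstab v, hw, hv,
      fun z hz => m.mem_of_le hd (sup_le (WayBelow.le hz.1) (WayBelow.le hz.2))⟩
  refine isPullback_of_existsUnique (by rw [F_map_comp, F_map_comp]) fun B a b hab => ?_
  have hcomp : ∀ (k l : SFilt L) (hk : x ∈ k.1) (hl : y ∈ l.1), ∃ e : B ⟶ G.obj (SFilt.inter k l),
      e ≫ G.map (homOfLE (SFilt.inter_le_left k l)) = a ≫ p.t x k hk ∧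
      e ≫ G.map (homOfLE (SFilt.inter_le_right k l)) = b ≫ p.t y l hl := by
    intro k l hk hl
    have hxj : x ∈ (SFilt.join hcont hstab k l).1 := ⟨x, hk, y, hl, inf_le_left⟩
    have hyj : y ∈ (SFilt.join hcont hstab k l).1 := ⟨x, hk, y, hl, inf_le_right⟩
    have hxyj : x ⊓ y ∈ (SFilt.join hcont hstab k l).1 := ⟨x, hk, y, hl, le_rfl⟩
    have heq : (a ≫ p.t x k hk) ≫
        G.map (homOfLE ((SFilt.isLUB_join hcont hstab k l).1 (Or.inl rfl))) =
        (b ≫ p.t y l hl) ≫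
        G.map (homOfLE ((SFilt.isLUB_join hcont hstab k l).1 (Or.inr rfl))) := by
      rw [Category.assoc, Category.assoc, p.t_map x k _ hk hxj, p.t_map y l _ hl hyj,
        ← p.map_t (x ⊓ y) x _ hxyj hxj inf_le_left, ← p.map_t (x ⊓ y) y _ hxyj hyj inf_le_right,
        ← Category.assoc, ← Category.assoc, hab]
    exact ⟨(hPB k l).lift _ _ heq, (hPB k l).lift_fst _ _ heq, (hPB k l).lift_snd _ _ heq⟩
  choose e he₁ he₂ using hcomp
  have hmono : ∀ k l k' l' (hk : x ∈ k.1) (hl : y ∈ l.1) (hk' : x ∈ k'.1) (hl' : y ∈ l'.1)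
      (hkk : k ≤ k') (hll : l ≤ l') (h : SFilt.inter k l ≤ SFilt.inter k' l'),
      e k l hk hl ≫ G.map (homOfLE h) = e k' l' hk' hl' := by
    intro k l k' l' hk hl hk' hl' hkk hll h
    refine (hPB k' l').hom_ext ?_ ?_
    · rw [Category.assoc, G_map_comp, he₁, ← p.t_map x k k' hk hk' hkk, ← Category.assoc,
        ← he₁ k l hk hl, Category.assoc, G_map_comp]
    · rw [Category.assoc, G_map_comp, he₂, ← p.t_map y l l' hl hl' hll, ← Category.assoc,
        ← he₂ k l hk hl, Category.assoc, G_map_comp]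
  have hindep : ∀ m k l k' l' (hk : x ∈ k.1) (hl : y ∈ l.1) (hk' : x ∈ k'.1) (hl' : y ∈ l'.1)
      (h : SFilt.inter k l ≤ m) (h' : SFilt.inter k' l' ≤ m),
      e k l hk hl ≫ G.map (homOfLE h) = e k' l' hk' hl' ≫ G.map (homOfLE h') := by
    intro m k l k' l' hk hl hk' hl' h h'
    have i₁ : SFilt.inter k k' ≤ k := SFilt.inter_le_left _ _
    have i₂ : SFilt.inter k k' ≤ k' := SFilt.inter_le_right _ _
    have j₁ : SFilt.inter l l' ≤ l := SFilt.inter_le_left _ _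
    have j₂ : SFilt.inter l l' ≤ l' := SFilt.inter_le_right _ _
    have hx : x ∈ (SFilt.inter k k').1 := ⟨hk, hk'⟩
    have hy : y ∈ (SFilt.inter l l').1 := ⟨hl, hl'⟩
    rw [← hmono _ _ k l hx hy hk hl i₁ j₁ (SFilt.le_inter
        ((SFilt.inter_le_left _ _).trans i₁) ((SFilt.inter_le_right _ _).trans j₁)),
      ← hmono _ _ k' l' hx hy hk' hl' i₂ j₂ (SFilt.le_inter
        ((SFilt.inter_le_left _ _).trans i₂) ((SFilt.inter_le_right _ _).trans j₂)),
      Category.assoc, Category.assoc, G_map_comp, G_map_comp]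
  choose κ μ hκ hμ hκμ using hsub
  obtain ⟨u, hu, huniq⟩ := hp (x ⊔ y) B
    (fun m hm => e _ _ (hκ m hm) (hμ m hm) ≫ G.map (homOfLE (hκμ m hm))) (by
      intro m n hm hn h
      rw [Category.assoc, G_map_comp]
      exact hindep _ _ _ _ _ _ _ _ _ _ _)
  refine ⟨u, ⟨hp.hom_ext fun k hk => ?_, hp.hom_ext fun l hl => ?_⟩, ?_⟩
  · rw [Category.assoc, p.map_t x _ k hk (k.mem_of_le hk le_sup_left), hu,
      ← he₁ k (SFilt.whole L) hk trivial]
    exact hindep _ _ _ _ _ _ _ _ _ _ _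
  · rw [Category.assoc, p.map_t y _ l hl (l.mem_of_le hl le_sup_right), hu,
      ← he₂ (SFilt.whole L) l trivial hl]
    exact hindep _ _ _ _ _ _ _ _ _ _ _
  · rintro u' ⟨hu₁, hu₂⟩
    refine huniq u' fun m hm => ?_
    have hmem : x ⊔ y ∈ (SFilt.inter (κ m hm) (μ m hm)).1 :=
      ⟨SFilt.mem_of_le _ (hκ m hm) le_sup_left, SFilt.mem_of_le _ (hμ m hm) le_sup_right⟩
    rw [← p.t_map _ _ m hmem hm (hκμ m hm), ← Category.assoc]
    congr 1
    refine (hPB _ _).hom_ext ?_ ?_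
    · rw [he₁, Category.assoc, p.t_map _ _ _ hmem hmem.1, ← hu₁, Category.assoc,
        p.map_t _ _ _ (hκ m hm) hmem.1]
    · rw [he₂, Category.assoc, p.t_map _ _ _ hmem hmem.2, ← hu₂, Category.assoc,
        p.map_t _ _ _ (hμ m hm) hmem.2]

/-- The restriction of `F` along an antitone map. -/
def diagram {J : Type w} [PartialOrder J] (F : Lᵒᵖ ⥤ C) (q : J → L) (hq : Antitone q) :
    J ⥤ C where
  obj j := F.obj (op (q j))
  map f := F.map (homOfLE (hq (leOfHom f))).op
  map_id _ := F.map_id _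
  map_comp _ _ := (F_map_comp F _ _).symm

/-- The comparison of the diagrams attached to two antitone maps. -/
def diagramTrans {J : Type w} [PartialOrder J] (F : Lᵒᵖ ⥤ C) {q q' : J → L} (hq : Antitone q)
    (hq' : Antitone q') (h : ∀ j, q' j ≤ q j) : diagram F q hq ⟶ diagram F q' hq' where
  app j := F.map (homOfLE (h j)).op
  naturality i j f :=
    (F_map_comp F (h j) (hq (leOfHom f))).trans (F_map_comp F (hq' (leOfHom f)) (h i)).symm

/-- The cocone with apex `G k` over a diagram of elements of `k`. -/
def cocone (p : Pairing F G) (k : SFilt L) {J : Type w} [PartialOrder J] (q : J → L)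
    (hq : Antitone q) (hqk : ∀ j, q j ∈ k.1) : Cocone (diagram F q hq) where
  pt := G.obj k
  ι :=
    { app := fun j => p.t (q j) k (hqk j)
      naturality := fun i j f =>
        (p.map_t _ _ k (hqk j) (hqk i) (hq (leOfHom f))).trans (Category.comp_id _).symm }

theorem IsColim.existsUnique_of_cofinal {p : Pairing F G} (hp : p.IsColim) (k : SFilt L)
    {J : Type w} [PartialOrder J] [IsDirected J (· ≤ ·)] (q : J → L) (hq : Antitone q)
    (hqk : ∀ j, q j ∈ k.1) (hcof : ∀ x ∈ k.1, ∃ j, q j ≤ x) (B : C)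
    (c : ∀ j, F.obj (op (q j)) ⟶ B)
    (hc : ∀ i j (h : i ≤ j), F.map (homOfLE (hq h)).op ≫ c j = c i) :
    ∃! u : G.obj k ⟶ B, ∀ j, p.t (q j) k (hqk j) ≫ u = c j := by
  choose ν hν using hcof
  have hindep : ∀ x i j (hi : q i ≤ x) (hj : q j ≤ x),
      F.map (homOfLE hi).op ≫ c i = F.map (homOfLE hj).op ≫ c j := by
    intro x i j hi hj
    obtain ⟨m, him, hjm⟩ := exists_ge_ge i j
    rw [← hc i m him, ← hc j m hjm, ← Category.assoc, ← Category.assoc, F_map_comp, F_map_comp]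
  obtain ⟨u, hu, huniq⟩ := hp k B (fun x hx => F.map (homOfLE (hν x hx)).op ≫ c (ν x hx)) (by
    intro x y hx hy h
    rw [← Category.assoc, F_map_comp]
    exact hindep _ _ _ _ _)
  refine ⟨u, fun j => ?_, fun u' hu' => huniq u' fun x hx => ?_⟩
  · rw [hu, hindep _ _ j _ le_rfl]
    exact hc j j le_rfl
  · rw [← hu', ← Category.assoc, p.map_t _ _ k (hqk _) hx]

theorem IsColim.nonempty_isColimit {p : Pairing F G} (hp : p.IsColim) (k : SFilt L) {J : Type w}
    [PartialOrder J] [IsDirected J (· ≤ ·)] (q : J → L) (hq : Antitone q)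
    (hqk : ∀ j, q j ∈ k.1) (hcof : ∀ x ∈ k.1, ∃ j, q j ≤ x) :
    Nonempty (IsColimit (p.cocone k q hq hqk)) := by
  have key := fun s : Cocone (diagram F q hq) =>
    hp.existsUnique_of_cofinal k q hq hqk hcof s.pt s.ι.app fun i j h => s.w (homOfLE h)
  choose u hu huniq using key
  exact ⟨⟨u, hu, huniq⟩⟩

theorem ι_colimMap_diagramTrans [HasColimitsOfSize.{w, w} C] {p : Pairing F G} {J : Type w}
    [PartialOrder J] {n n' : SFilt L} (h : n ≤ n') {q q' : J → L} {hq : Antitone q}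
    {hq' : Antitone q'} {hqn : ∀ i, q i ∈ n.1} {hqn' : ∀ i, q' i ∈ n'.1} (hle : ∀ i, q' i ≤ q i)
    (c : IsColimit (p.cocone n q hq hqn)) (c' : IsColimit (p.cocone n' q' hq' hqn')) :
    colim.map (diagramTrans F hq hq' hle) ≫
        ((colimit.isColimit _).coconePointUniqueUpToIso c').hom =
      ((colimit.isColimit _).coconePointUniqueUpToIso c).hom ≫ G.map (homOfLE h) := by
  refine colimit.hom_ext fun i => ?_
  have h₁ : colimit.ι (diagram F q hq) i ≫
      ((colimit.isColimit _).coconePointUniqueUpToIso c).hom = p.t (q i) n (hqn i) :=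
    IsColimit.comp_coconePointUniqueUpToIso_hom (colimit.isColimit _) c i
  have h₂ : colimit.ι (diagram F q' hq') i ≫
      ((colimit.isColimit _).coconePointUniqueUpToIso c').hom = p.t (q' i) n' (hqn' i) :=
    IsColimit.comp_coconePointUniqueUpToIso_hom (colimit.isColimit _) c' i
  have h₃ : colimit.ι (diagram F q hq) i ≫ colim.map (diagramTrans F hq hq' hle) =
      F.map (homOfLE (hle i)).op ≫ colimit.ι (diagram F q' hq') i :=
    colimit.ι_map _ _
  have key : F.map (homOfLE (hle i)).op ≫ p.t (q' i) n' (hqn' i) =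
      p.t (q i) n (hqn i) ≫ G.map (homOfLE h) := by
    rw [p.map_t _ _ n' _ (h (hqn i)), p.t_map _ n n' _ (h (hqn i))]
  exact (Category.assoc _ _ _).symm.trans ((congrArg (· ≫ _) h₃).trans
    ((Category.assoc _ _ _).trans ((congrArg (_ ≫ ·) h₂).trans (key.trans
      ((congrArg (· ≫ _) h₁.symm).trans (Category.assoc _ _ _))))))

theorem IsColim.isPullback_of_cofinal [HasFiniteLimits C] [HasColimitsOfSize.{w, w} C]
    {p : Pairing F G} (hp : p.IsColim)
    (hF : ∀ x y : L, IsPullback (F.map (homOfLE (le_sup_left : x ≤ x ⊔ y)).op)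
      (F.map (homOfLE (le_sup_right : y ≤ x ⊔ y)).op)
      (F.map (homOfLE (inf_le_left : x ⊓ y ≤ x)).op)
      (F.map (homOfLE (inf_le_right : x ⊓ y ≤ y)).op))
    {J : Type w} [PartialOrder J] [IsDirected J (· ≤ ·)]
    [PreservesFiniteLimits (colim (J := J) (C := C))]
    {k l m j : SFilt L} (hmk : m ≤ k) (hml : m ≤ l) (hkj : k ≤ j) (hlj : l ≤ j)
    {a b : J → L} (ha : Antitone a) (hb : Antitone b)
    (hak : ∀ i, a i ∈ k.1) (hbl : ∀ i, b i ∈ l.1)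
    (habm : ∀ i, a i ⊔ b i ∈ m.1) (habj : ∀ i, a i ⊓ b i ∈ j.1)
    (hk : ∀ x ∈ k.1, ∃ i, a i ≤ x) (hl : ∀ x ∈ l.1, ∃ i, b i ≤ x)
    (hm : ∀ x ∈ m.1, ∃ i, a i ⊔ b i ≤ x) (hj : ∀ x ∈ j.1, ∃ i, a i ⊓ b i ≤ x) :
    IsPullback (G.map (homOfLE hmk)) (G.map (homOfLE hml))
      (G.map (homOfLE hkj)) (G.map (homOfLE hlj)) := by
  have hsup : Antitone fun i => a i ⊔ b i := fun i i' h => sup_le_sup (ha h) (hb h)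
  have hinf : Antitone fun i => a i ⊓ b i := fun i i' h => inf_le_inf (ha h) (hb h)
  obtain ⟨cm⟩ := hp.nonempty_isColimit m _ hsup habm hm
  obtain ⟨ck⟩ := hp.nonempty_isColimit k a ha hak hk
  obtain ⟨cl⟩ := hp.nonempty_isColimit l b hb hbl hl
  obtain ⟨cj⟩ := hp.nonempty_isColimit j _ hinf habj hj
  have hsq : IsPullback (diagramTrans F hsup ha fun i => le_sup_left)
      (diagramTrans F hsup hb fun i => le_sup_right)
      (diagramTrans F ha hinf fun i => inf_le_left)
      (diagramTrans F hb hinf fun i => inf_le_right) :=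
    IsPullback.of_forall_isPullback_app fun i => hF (a i) (b i)
  exact (hsq.map colim).of_iso _ _ _ _ (ι_colimMap_diagramTrans hmk _ cm ck)
    (ι_colimMap_diagramTrans hml _ cm cl) (ι_colimMap_diagramTrans hkj _ ck cj)
    (ι_colimMap_diagramTrans hlj _ cl cj)

theorem IsColim.isPullback [HasFiniteLimits C] [HasColimitsOfSize.{w, w} C]
    (hcont : IsContinuousLattice L) (hstab : IsStable L)
    (hcomm : ∀ (J : Type w) [PartialOrder J] [Nonempty J] [IsDirected J (· ≤ ·)],
      PreservesFiniteLimits (colim (J := J) (C := C)))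
    {p : Pairing F G} (hp : p.IsColim)
    (hF : ∀ x y : L, IsPullback (F.map (homOfLE (le_sup_left : x ≤ x ⊔ y)).op)
      (F.map (homOfLE (le_sup_right : y ≤ x ⊔ y)).op)
      (F.map (homOfLE (inf_le_left : x ⊓ y ≤ x)).op)
      (F.map (homOfLE (inf_le_right : x ⊓ y ≤ y)).op))
    (k l m j : SFilt L) (hm : IsGLB {k, l} m) (hj : IsLUB {k, l} j)
    (hmk : m ≤ k) (hml : m ≤ l) (hkj : k ≤ j) (hlj : l ≤ j) :
    IsPullback (G.map (homOfLE hmk)) (G.map (homOfLE hml))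
      (G.map (homOfLE hkj)) (G.map (homOfLE hlj)) := by
  have hjoin : j ≤ SFilt.join hcont hstab k l := hj.2 (SFilt.isLUB_join hcont hstab k l).1
  have hinter : SFilt.inter k l ≤ m := hm.2 (SFilt.isGLB_inter k l).1
  let J : Type w := {x : L // x ∈ k.1}ᵒᵈ × {y : L // y ∈ l.1}ᵒᵈ
  let a : J → L := fun i => (OrderDual.ofDual i.1).1
  let b : J → L := fun i => (OrderDual.ofDual i.2).1
  have hak : ∀ i, a i ∈ k.1 := fun i => (OrderDual.ofDual i.1).2
  have hbl : ∀ i, b i ∈ l.1 := fun i => (OrderDual.ofDual i.2).2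
  let mk : ∀ x y, x ∈ k.1 → y ∈ l.1 → J := fun x y hx hy =>
    (OrderDual.toDual ⟨x, hx⟩, OrderDual.toDual ⟨y, hy⟩)
  have ha : Antitone a := fun i i' h => h.1
  have hb : Antitone b := fun i i' h => h.2
  have : Nonempty J := ⟨mk ⊤ ⊤ k.top_mem l.top_mem⟩
  have : IsDirected J (· ≤ ·) := ⟨fun i i' =>
    ⟨mk (a i ⊓ a i') (b i ⊓ b i') (k.inf_mem (hak i) (hak i')) (l.inf_mem (hbl i) (hbl i')),
      ⟨show a i ⊓ a i' ≤ a i from inf_le_left, show b i ⊓ b i' ≤ b i from inf_le_left⟩,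
      ⟨show a i ⊓ a i' ≤ a i' from inf_le_right, show b i ⊓ b i' ≤ b i' from inf_le_right⟩⟩⟩
  have := hcomm J
  refine hp.isPullback_of_cofinal hF (J := J) hmk hml hkj hlj ha hb hak hbl
    (fun i => hinter ⟨k.mem_of_le (hak i) le_sup_left, l.mem_of_le (hbl i) le_sup_right⟩)
    (fun i => j.inf_mem (hkj (hak i)) (hlj (hbl i)))
    (fun x hx => ⟨mk x ⊤ hx l.top_mem, le_rfl⟩) (fun y hy => ⟨mk ⊤ y k.top_mem hy, le_rfl⟩)
    (fun x hx => ⟨mk x x (hmk hx) (hml hx), sup_le le_rfl le_rfl⟩) (fun z hz => ?_)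
  obtain ⟨x, hx, y, hy, h⟩ := hjoin hz
  exact ⟨mk x y hx hy, h⟩

theorem IsLim.existsUnique_natTrans {F' : Lᵒᵖ ⥤ C} {G' : SFilt L ⥤ C} (p : Pairing F G)
    {p' : Pairing F' G'} (hp' : p'.IsLim) (α : G ⟶ G') :
    ∃! β : F ⟶ F', ∀ x k hk, β.app (op x) ≫ p'.t x k hk = p.t x k hk ≫ α.app k := by
  have key := fun x : L => hp' x (F.obj (op x)) (fun k hk => p.t x k hk ≫ α.app k) (by
    intro k l hk hl h
    rw [Category.assoc, ← α.naturality, ← Category.assoc, p.t_map x k l hk hl h])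
  choose β hβ huniq using key
  refine ⟨{ app := fun x => β x.unop, naturality := fun x y f => ?_ }, hβ, fun β' hβ' => ?_⟩
  · refine hp'.hom_ext fun k hk => ?_
    have hx := k.mem_of_le hk (leOfHom f.unop)
    have e : F'.map f ≫ p'.t y.unop k hk = p'.t x.unop k hx := p'.map_t y.unop x.unop k hk hx _
    have e' : F.map f ≫ p.t y.unop k hk = p.t x.unop k hx := p.map_t y.unop x.unop k hk hx _
    rw [Category.assoc, Category.assoc, hβ, e, hβ, ← e', Category.assoc]
  · ext x
    exact huniq x.unop _ fun k hk => hβ' x.unop k hk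

theorem IsColim.existsUnique_natTrans {F' : Lᵒᵖ ⥤ C} {G' : SFilt L ⥤ C} {p : Pairing F G}
    (hp : p.IsColim) (p' : Pairing F' G') (β : F ⟶ F') :
    ∃! α : G ⟶ G', ∀ x k hk, β.app (op x) ≫ p'.t x k hk = p.t x k hk ≫ α.app k := by
  have key := fun k : SFilt L => hp k (G'.obj k) (fun x hk => β.app (op x) ≫ p'.t x k hk) (by
    intro x y hx hy h
    rw [← Category.assoc, β.naturality, Category.assoc, p'.map_t x y k hx hy h])
  choose α hα huniq using key
  refine ⟨{ app := α, naturality := fun k l f => ?_ }, fun x k hk => (hα k x hk).symm,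
    fun α' hα' => ?_⟩
  · refine hp.hom_ext fun x hx => ?_
    have hl := leOfHom f hx
    have e : p'.t x k hx ≫ G'.map f = p'.t x l hl := p'.t_map x k l hx hl _
    have e' : p.t x k hx ≫ G.map f = p.t x l hl := p.t_map x k l hx hl _
    rw [← Category.assoc, ← Category.assoc, hα, e', hα, ← e, Category.assoc]
  · ext k
    exact huniq k _ fun x hx => (hα' x k hx).symm

theorem IsLim.isIso_t_of_isBot {p : Pairing F G} (hp : p.IsLim) {x : L} {k : SFilt L}
    (hk : x ∈ k.1) (h : ∀ l : SFilt L, x ∈ l.1 → k ≤ l) : IsIso (p.t x k hk) := by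
  obtain ⟨u, hu, -⟩ := hp x (G.obj k) (fun l hl => G.map (homOfLE (h l hl)))
    (fun l m _ _ hlm => G_map_comp G _ hlm)
  refine ⟨u, hp.hom_ext fun l hl => ?_, ?_⟩
  · rw [Category.assoc, hu, Category.id_comp, p.t_map x k l hk hl]
  · rw [hu]
    exact G.map_id k

theorem IsColim.isIso_t_of_isBot {p : Pairing F G} (hp : p.IsColim) {x : L} {k : SFilt L}
    (hk : x ∈ k.1) (h : ∀ y ∈ k.1, x ≤ y) : IsIso (p.t x k hk) := by
  obtain ⟨u, hu, -⟩ := hp k (F.obj (op x)) (fun y hy => F.map (homOfLE (h y hy)).op)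
    (fun y z _ _ hyz => F_map_comp F _ hyz)
  refine ⟨u, ?_, hp.hom_ext fun y hy => ?_⟩
  · rw [hu]
    exact F.map_id (op x)
  · rw [← Category.assoc, hu, Category.comp_id, p.map_t x y k hk hy]

/-- The smallest Scott-open filter of a stably continuous lattice consists of the top element. -/
theorem _root_.SFilt.eq_top_of_mem_isBot (hstab : IsStable L) {b : SFilt L} (hb : IsBot b) {x : L}
    (hx : x ∈ b.1) : x = ⊤ := by
  let s : SFilt L := ⟨{x | x = ⊤}, ⟨⟨⊤, rfl⟩, fun x hx y h => top_le_iff.1 (hx ▸ h),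
    fun x hx y hy => ⟨⊤, rfl, le_of_eq hx.symm, le_of_eq hy.symm⟩⟩, by
    rintro D hD hdir t ht rfl
    obtain ⟨d, hd, h⟩ := hstab.1 D hD hdir _ ht le_rfl
    exact ⟨d, hd, top_le_iff.1 h⟩⟩
  exact hb s hx

theorem mono_terminal_from_of_iso [HasFiniteLimits C] {X Y : C} (f : X ⟶ Y) [IsIso f]
    [Mono (terminal.from Y)] : Mono (terminal.from X) := by
  rw [Subsingleton.elim (terminal.from X) (f ≫ terminal.from Y)]
  infer_instance

theorem IsLim.isOmegaSheaf [HasFiniteLimits C] (hcont : IsContinuousLattice L)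
    (hstab : IsStable L) {p : Pairing F G} (hp : p.IsLim) (hG : IsKSheafOnOp G) :
    IsOmegaSheaf F := by
  refine ⟨?_, hp.isPullback hcont hstab hG.2.1, hp.isLimitOn⟩
  have := hp.isIso_t_of_isBot (x := ⊥) (k := SFilt.whole L) trivial
    fun l hl x _ => l.mem_of_le hl bot_le
  have := hG.1 (SFilt.whole L) fun k x _ => trivial
  exact mono_terminal_from_of_iso (p.t ⊥ (SFilt.whole L) trivial)

theorem IsColim.isKSheafOnOp [HasFiniteLimits C] [HasColimitsOfSize.{w, w} C]
    (hcont : IsContinuousLattice L) (hstab : IsStable L)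
    (hcomm : ∀ (J : Type w) [PartialOrder J] [Nonempty J] [IsDirected J (· ≤ ·)],
      PreservesFiniteLimits (colim (J := J) (C := C)))
    {p : Pairing F G} (hp : p.IsColim) (hF : IsOmegaSheaf F) : IsKSheafOnOp G := by
  refine ⟨fun k hk => ?_, hp.isPullback hcont hstab hcomm hF.2.1, hp.isColimitOn⟩
  have hbot : (⊥ : L) ∈ k.1 := hk (SFilt.whole L) trivial
  have := hp.isIso_t_of_isBot hbot fun y _ => bot_le
  have := hF.1
  exact mono_terminal_from_of_iso (inv (p.t ⊥ k hbot))

end Pairing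

section Representations

variable [HasFiniteLimits C] [HasLimitsOfSize.{w, w} C]

namespace KShrRepOp

variable {A : C} {b : SFilt L}

/-- The presheaf on `L` of limits of the values of a functor on Scott-open filters. -/
noncomputable def limPresheaf (X : KShrRepOp C A b) : Lᵒᵖ ⥤ C :=
  (Pairing.exists_isLim X.G).choose

/-- The limit pairing defining `limPresheaf`. -/
noncomputable def pairing (X : KShrRepOp C A b) : Pairing X.limPresheaf X.G :=
  (Pairing.exists_isLim X.G).choose_spec.choose

theorem isLim_pairing (X : KShrRepOp C A b) : X.pairing.IsLim :=
  (Pairing.exists_isLim X.G).choose_spec.choose_spec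

/-- The Ω-sheaf representation of `A` attached to a K-sheaf representation of `A`. -/
noncomputable def toOmShrRep (hcont : IsContinuousLattice L) (hstab : IsStable L) (hb : IsBot b)
    (X : KShrRepOp C A b) : OmShrRep C (L := L) A :=
  have : IsIso (X.pairing.t ⊤ b b.top_mem) :=
    X.isLim_pairing.isIso_t_of_isBot b.top_mem fun l _ => hb l
  have := X.iso
  { F := X.limPresheaf
    osheaf := X.isLim_pairing.isOmegaSheaf hcont hstab X.ksheaf
    φ := X.φ ≫ inv (X.pairing.t ⊤ b b.top_mem)
    iso := inferInstance }

theorem toOmShrRep_φ_comp (hcont : IsContinuousLattice L) (hstab : IsStable L) (hb : IsBot b)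
    (X : KShrRepOp C A b) :
    (X.toOmShrRep hcont hstab hb).φ ≫ X.pairing.t ⊤ b b.top_mem = X.φ := by
  have : IsIso (X.pairing.t ⊤ b b.top_mem) :=
    X.isLim_pairing.isIso_t_of_isBot b.top_mem fun l _ => hb l
  have h : inv (X.pairing.t ⊤ b b.top_mem) ≫ X.pairing.t ⊤ b b.top_mem = 𝟙 _ :=
    IsIso.inv_hom_id _
  exact (Category.assoc _ _ _).trans ((congrArg (X.φ ≫ ·) h).trans (Category.comp_id _))

/-- The natural transformation induced between the presheaves of limits. -/
noncomputable def limMap {X Y : KShrRepOp C A b} (f : X ⟶ Y) : X.limPresheaf ⟶ Y.limPresheaf :=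
  (Pairing.IsLim.existsUnique_natTrans X.pairing Y.isLim_pairing f.1).choose

theorem limMap_comp_t {X Y : KShrRepOp C A b} (f : X ⟶ Y) (x : L) (k : SFilt L) (hk : x ∈ k.1) :
    (limMap f).app (op x) ≫ Y.pairing.t x k hk = X.pairing.t x k hk ≫ f.1.app k :=
  (Pairing.IsLim.existsUnique_natTrans X.pairing Y.isLim_pairing f.1).choose_spec.1 x k hk

theorem eq_limMap {X Y : KShrRepOp C A b} (f : X ⟶ Y) (β : X.limPresheaf ⟶ Y.limPresheaf)
    (h : ∀ x k hk, β.app (op x) ≫ Y.pairing.t x k hk = X.pairing.t x k hk ≫ f.1.app k) :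
    β = limMap f :=
  (Pairing.IsLim.existsUnique_natTrans X.pairing Y.isLim_pairing f.1).choose_spec.2 β h

theorem φ_comp_eq_iff (hcont : IsContinuousLattice L) (hstab : IsStable L) (hb : IsBot b)
    {X Y : KShrRepOp C A b} (α : X.G ⟶ Y.G) (β : X.limPresheaf ⟶ Y.limPresheaf)
    (h : β.app (op ⊤) ≫ Y.pairing.t ⊤ b b.top_mem = X.pairing.t ⊤ b b.top_mem ≫ α.app b) :
    (X.toOmShrRep hcont hstab hb).φ ≫ β.app (op ⊤) = (Y.toOmShrRep hcont hstab hb).φ ↔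
      X.φ ≫ α.app b = Y.φ := by
  have := Y.isLim_pairing.isIso_t_of_isBot b.top_mem fun l _ => hb l
  have hX := X.toOmShrRep_φ_comp hcont hstab hb
  have hY := Y.toOmShrRep_φ_comp hcont hstab hb
  have key : ((X.toOmShrRep hcont hstab hb).φ ≫ β.app (op ⊤)) ≫ Y.pairing.t ⊤ b b.top_mem =
      X.φ ≫ α.app b :=
    (Category.assoc _ _ _).trans ((congrArg (_ ≫ ·) h).trans
      ((Category.assoc _ _ _).symm.trans (congrArg (· ≫ _) hX)))
  constructor
  · intro e
    exact key.symm.trans ((congrArg (· ≫ _) e).trans hY)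
  · intro e
    exact (cancel_mono (Y.pairing.t ⊤ b b.top_mem)).1 (key.trans (e.trans hY.symm))

/-- The functor from K-sheaf representations to Ω-sheaf representations. -/
noncomputable def toOmShrRepFunctor (hcont : IsContinuousLattice L) (hstab : IsStable L)
    (hb : IsBot b) : KShrRepOp C A b ⥤ OmShrRep C (L := L) A where
  obj X := X.toOmShrRep hcont hstab hb
  map {X Y} f := ⟨limMap f,
    (φ_comp_eq_iff hcont hstab hb f.1 (limMap f) (limMap_comp_t f ⊤ b b.top_mem)).2 f.2⟩
  map_id X := Subtype.ext (eq_limMap (𝟙 X) (𝟙 X.limPresheaf) fun x k hk =>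
    (Category.id_comp _).trans (Category.comp_id _).symm).symm
  map_comp {X Y Z} f g := Subtype.ext (eq_limMap (f ≫ g) (limMap f ≫ limMap g) fun x k hk => by
    rw [NatTrans.comp_app, Category.assoc, limMap_comp_t, ← Category.assoc, limMap_comp_t,
      Category.assoc]
    rfl).symm

end KShrRepOp

end Representations

end PairingSec

theorem statement17 {L : Type w} [CompleteLattice L]
    (hcont : ∀ x : L, (wb x).Nonempty ∧ DirectedOn (· ≤ ·) (wb x) ∧ IsLUB (wb x) x)
    (hstab : WayBelow (⊤ : L) (⊤ : L) ∧
      ∀ x y z : L, WayBelow x y → WayBelow x z → WayBelow x (y ⊓ z))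
    {C : Type u} [Category.{v} C]
    [HasFiniteLimits C] [RegularCat C]
    [HasLimitsOfSize.{w, w} C] [HasColimitsOfSize.{w, w} C]
    (hcomm : ∀ (J : Type w) [PartialOrder J] [Nonempty J] [IsDirected J (· ≤ ·)],
      PreservesFiniteLimits (colim (J := J) (C := C)))
    (A : C) (b : SFilt L) (hb : IsBot b) :
    Nonempty (KShrRepOp C A b ≌ OmShrRep C (L := L) A) := by
  let Φ : KShrRepOp C A b ⥤ OmShrRep C (L := L) A :=
    KShrRepOp.toOmShrRepFunctor hcont hstab hb
  have hcolim : ∀ X : KShrRepOp C A b, X.pairing.IsColim := fun X =>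
    X.isLim_pairing.isColim hcont hstab X.ksheaf.2.2
  have : Φ.Faithful := ⟨fun {X Y} f g hfg => by
    have h : KShrRepOp.limMap f = KShrRepOp.limMap g := congrArg Subtype.val hfg
    refine Subtype.ext (((hcolim X).existsUnique_natTrans Y.pairing (KShrRepOp.limMap f)).unique
      (KShrRepOp.limMap_comp_t f) ?_)
    rw [h]
    exact KShrRepOp.limMap_comp_t g⟩
  have : Φ.Full := ⟨fun {X Y} β => by
    obtain ⟨α, hα, -⟩ := (hcolim X).existsUnique_natTrans Y.pairing β.1
    let f : X ⟶ Y := ⟨α, (KShrRepOp.φ_comp_eq_iff hcont hstab hb α β.1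
      (hα ⊤ b b.top_mem)).1 β.2⟩
    exact ⟨f, Subtype.ext (KShrRepOp.eq_limMap f β.1 hα).symm⟩⟩
  have : Φ.EssSurj := ⟨fun Z => by
    obtain ⟨G, p, hp⟩ := Pairing.exists_isColim Z.F
    have hpl : p.IsLim := hp.isLim hcont hstab Z.osheaf.2.2
    have := hp.isIso_t_of_isBot b.top_mem fun y hy =>
      (SFilt.eq_top_of_mem_isBot hstab hb hy).ge
    have := Z.iso
    let X : KShrRepOp C A b :=
      ⟨G, hp.isKSheafOnOp hcont hstab hcomm Z.osheaf, Z.φ ≫ p.t ⊤ b b.top_mem, inferInstance⟩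
    have hX : (Φ.obj X).φ ≫ X.pairing.t ⊤ b b.top_mem = Z.φ ≫ p.t ⊤ b b.top_mem :=
      X.toOmShrRep_φ_comp hcont hstab hb
    obtain ⟨β, hβ, -⟩ := hpl.existsUnique_natTrans X.pairing (𝟙 G)
    obtain ⟨γ, hγ, -⟩ := X.isLim_pairing.existsUnique_natTrans p (𝟙 G)
    have hβ' : ∀ x k hk, β.app (op x) ≫ p.t x k hk = X.pairing.t x k hk := fun x k hk =>
      (hβ x k hk).trans (Category.comp_id _)
    have hγ' : ∀ x k hk, γ.app (op x) ≫ X.pairing.t x k hk = p.t x k hk := fun x k hk =>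
      (hγ x k hk).trans (Category.comp_id _)
    have hφβ : (Φ.obj X).φ ≫ β.app (op ⊤) = Z.φ :=
      (cancel_mono (p.t ⊤ b b.top_mem)).1 ((Category.assoc _ _ _).trans
        ((congrArg (_ ≫ ·) (hβ' ⊤ b b.top_mem)).trans hX))
    have h₁ : β ≫ γ = 𝟙 X.limPresheaf := by
      ext x
      refine X.isLim_pairing.hom_ext fun k hk => ?_
      rw [NatTrans.comp_app, Category.assoc, NatTrans.id_app, Category.id_comp]
      exact (congrArg (_ ≫ ·) (hγ' x.unop k hk)).trans (hβ' x.unop k hk)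
    have hφγ : Z.φ ≫ γ.app (op ⊤) = (Φ.obj X).φ :=
      (congrArg (· ≫ γ.app (op ⊤)) hφβ.symm).trans ((Category.assoc _ _ _).trans
        ((congrArg ((Φ.obj X).φ ≫ ·) (congrArg (fun t => t.app (op ⊤)) h₁)).trans
          (Category.comp_id _)))
    have h₂ : γ ≫ β = 𝟙 Z.F := by
      ext x
      refine hpl.hom_ext fun k hk => ?_
      rw [NatTrans.comp_app, Category.assoc, NatTrans.id_app, Category.id_comp]
      exact (congrArg (_ ≫ ·) (hβ' x.unop k hk)).trans (hγ' x.unop k hk)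
    exact ⟨X, ⟨{ hom := ⟨β, hφβ⟩
                 inv := ⟨γ, hφγ⟩
                 hom_inv_id := Subtype.ext h₁
                 inv_hom_id := Subtype.ext h₂ }⟩⟩⟩
  have : Φ.IsEquivalence := {}
  exact ⟨Φ.asEquivalence⟩
end

section
/- Let C be a finitely cocomplete Barr-exact category, A an object of C, and θ₁, θ₂ equivalence relations on A. Then θ₁ and θ₂ commute (θ₁ ∘ θ₂ = θ₂ ∘ θ₁ as relations on A) if and only if the commutative square of canonical regular epimorphisms A/(θ₁ ∧ θ₂) → A/θ₁, A/(θ₁ ∧ θ₂) → A/θ₂, A/θ₁ → A/(θ₁ ∨ θ₂), A/θ₂ → A/(θ₁ ∨ θ₂) is a pullback square in C. -/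
open CategoryTheory CategoryTheory.Limits Opposite

universe w v u

variable {C : Type u} [Category.{v} C]

structure RegEpiOver (A : C) : Type (max u v) where
  cod : C
  hom : A ⟶ cod
  regEpi : Nonempty (RegularEpi hom)

/-- f ≤ g in RegEpi(A) iff g = h ∘ f for some h. -/
def RegEpiOver.le {A : C} (f g : RegEpiOver A) : Prop :=
  ∃ h : f.cod ⟶ g.cod, f.hom ≫ h = g.hom

variable [HasFiniteLimits C]

/-- The kernel pair of f, as a map into A ⨯ A. -/
noncomputable def kerPairMap {A B : C} (f : A ⟶ B) : pullback f f ⟶ A ⨯ A :=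
  prod.lift (pullback.fst f f) (pullback.snd f f)

/-- The object U in the construction of the composite of two relations r : R ↣ A × A and
s : S ↣ A × A: the equaliser of the two maps R ⨯ S ⟶ A given by the second leg of r and
the first leg of s. -/
noncomputable def relCompDom {A R S : C} (r : R ⟶ A ⨯ A) (s : S ⟶ A ⨯ A) : C :=
  equalizer ((prod.fst : R ⨯ S ⟶ R) ≫ r ≫ (prod.snd : A ⨯ A ⟶ A))
    ((prod.snd : R ⨯ S ⟶ S) ≫ s ≫ (prod.fst : A ⨯ A ⟶ A))

/-- The canonical map U ⟶ A ⨯ A whose image is the composite relation r ∘ s. -/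
noncomputable def relCompMap {A R S : C} (r : R ⟶ A ⨯ A) (s : S ⟶ A ⨯ A) :
    relCompDom r s ⟶ A ⨯ A :=
  equalizer.ι _ _ ≫
    prod.lift ((prod.fst : R ⨯ S ⟶ R) ≫ r ≫ (prod.fst : A ⨯ A ⟶ A))
      ((prod.snd : R ⨯ S ⟶ S) ≫ s ≫ (prod.snd : A ⨯ A ⟶ A))

/-- t : T ⟶ A ⨯ A is (an image factorisation of) the composite relation of r and s. -/
def IsRelComp {A R S T : C} (r : R ⟶ A ⨯ A) (s : S ⟶ A ⨯ A) (t : T ⟶ A ⨯ A) : Prop :=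
  ∃ e : relCompDom r s ⟶ T, Nonempty (RegularEpi e) ∧ e ≫ t = relCompMap r s

/-- Two monomorphisms into X determine the same subobject. -/
def SameSub {X T W : C} (t : T ⟶ X) (w : W ⟶ X) : Prop :=
  (∃ u : T ⟶ W, u ≫ w = t) ∧ (∃ v : W ⟶ T, v ≫ t = w)

/-- A relation t on A is effective if it is, as a subobject of A ⨯ A, the kernel pair
of some morphism. -/
def IsEffective {A T : C} (t : T ⟶ A ⨯ A) : Prop :=
  ∃ (B : C) (h : A ⟶ B), SameSub t (kerPairMap h)

/-- Two regular epimorphisms with domain A ker-commute: the composites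
ker f ∘ ker g and ker g ∘ ker f coincide (as subobjects of A ⨯ A) and this composite
is an effective equivalence relation. -/
def KerCommute {A : C} (f g : RegEpiOver A) : Prop :=
  ∃ (T : C) (t : T ⟶ A ⨯ A), Mono t ∧
    IsRelComp (kerPairMap f.hom) (kerPairMap g.hom) t ∧
    IsRelComp (kerPairMap g.hom) (kerPairMap f.hom) t ∧
    IsEffective t

section EquivRel

variable {A : C}

/-- Reflexivity of a relation r : R ⟶ A ⨯ A: the diagonal factors through it. -/
def ReflRel {R : C} (r : R ⟶ A ⨯ A) : Prop :=
  ∃ d : A ⟶ R, d ≫ r = prod.lift (𝟙 A) (𝟙 A)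

/-- Symmetry of a relation r : R ⟶ A ⨯ A. -/
def SymmRel {R : C} (r : R ⟶ A ⨯ A) : Prop :=
  ∃ s : R ⟶ R, s ≫ r = prod.lift (r ≫ prod.snd) (r ≫ prod.fst)

/-- Transitivity of a relation r : R ⟶ A ⨯ A, via the pullback of the two legs. -/
def TransRel {R : C} (r : R ⟶ A ⨯ A) : Prop :=
  ∃ t : pullback (r ≫ (prod.snd : A ⨯ A ⟶ A)) (r ≫ (prod.fst : A ⨯ A ⟶ A)) ⟶ R,
    t ≫ r = prod.lift (pullback.fst _ _ ≫ r ≫ prod.fst) (pullback.snd _ _ ≫ r ≫ prod.snd)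

/-- A subobject of A ⨯ A is an (internal) equivalence relation. -/
def IsEquivRel (R : Subobject (A ⨯ A)) : Prop :=
  ReflRel R.arrow ∧ SymmRel R.arrow ∧ TransRel R.arrow

variable (A) in
/-- Equiv(A): the poset of equivalence relations on A, ordered as subobjects of A ⨯ A. -/
def EquivOn : Type (max u v) := {R : Subobject (A ⨯ A) // IsEquivRel R}

noncomputable instance : PartialOrder (EquivOn A) :=
  inferInstanceAs (PartialOrder {R : Subobject (A ⨯ A) // IsEquivRel R})

/-- Two equivalence relations commute: R ∘ S = S ∘ R as subobjects of A ⨯ A. -/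
def CommuteER (R S : EquivOn A) : Prop :=
  ∃ (T : C) (t : T ⟶ A ⨯ A), Mono t ∧
    IsRelComp ((R : {R : Subobject (A ⨯ A) // IsEquivRel R}).1.arrow) (S.1.arrow) t ∧
    IsRelComp (S.1.arrow) (R.1.arrow) t

end EquivRel

variable (C) in
/-- A Barr-exact category: a regular category in which every equivalence relation is
effective (i.e. a kernel pair). -/
class BarrExact extends RegularCat C : Prop where
  effective : ∀ (A : C) (R : Subobject (A ⨯ A)), IsEquivRel R →
    ∃ (B : C) (h : A ⟶ B), SameSub R.arrow (kerPairMap h)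

section Quotients

variable [HasFiniteColimits C] {A : C}

/-- The quotient A/θ of A by an equivalence relation θ: the coequaliser of the two
legs of θ. -/
noncomputable def quotER (θ : EquivOn A) : C :=
  coequalizer (θ.1.arrow ≫ (prod.fst : A ⨯ A ⟶ A)) (θ.1.arrow ≫ (prod.snd : A ⨯ A ⟶ A))

/-- The canonical projection A ↠ A/θ. -/
noncomputable def quotProj (θ : EquivOn A) : A ⟶ quotER θ :=
  coequalizer.π _ _

end Quotients

attribute [local simp] prod.lift_fst prod.lift_snd prod.lift_fst_assoc prod.lift_snd_assoc

section Covers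

variable [RegularCat C]

/-- In a regular category every strong epimorphism is regular. -/
theorem regularEpi_of_strongEpi {X Y : C} (f : X ⟶ Y) [StrongEpi f] :
    Nonempty (RegularEpi f) := by
  obtain ⟨Z, e, m, ⟨he⟩, hm, rfl⟩ := RegularCat.factor f
  have : StrongEpi m := strongEpi_of_strongEpi e m
  have : IsIso m := isIso_of_mono_of_strongEpi m
  exact ⟨he.ofArrowIso (Arrow.isoMk (f := .mk e) (g := .mk (e ≫ m)) (Iso.refl _) (asIso m))⟩

theorem strongEpi_of_regularEpi {D : Type u} [Category.{v} D] {X Y : D} {f : X ⟶ Y}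
    (hf : Nonempty (RegularEpi f)) : StrongEpi f :=
  have := isRegularEpi_of_regularEpi hf.some
  inferInstance

/-- A generalised element of the codomain of a strong epimorphism lifts locally. -/
theorem exists_local_lift {X A B : C} (q : A ⟶ B) [StrongEpi q] (b : X ⟶ B) :
    ∃ (X' : C) (e : X' ⟶ X) (x : X' ⟶ A), StrongEpi e ∧ x ≫ q = e ≫ b :=
  ⟨pullback q b, pullback.snd q b, pullback.fst q b,
    strongEpi_of_regularEpi (RegularCat.stable q b (regularEpi_of_strongEpi q)),
    pullback.condition⟩

end Covers

theorem exists_factor_of_strongEpi {D : Type u} [Category.{v} D] {X' X T Y : D} (e : X' ⟶ X)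
    [StrongEpi e] (t : T ⟶ Y) [Mono t] (f : X ⟶ Y) (k : X' ⟶ T) (hk : k ≫ t = e ≫ f) :
    ∃ l : X ⟶ T, l ≫ t = f :=
  have sq : CommSq k e t f := ⟨hk⟩
  ⟨sq.lift, sq.fac_right⟩

section Elements

variable {A : C}

/-- The generalised elements `x` and `y` of `A` are related by `r`. -/
def RelHolds {R X : C} (r : R ⟶ A ⨯ A) (x y : X ⟶ A) : Prop :=
  ∃ k : X ⟶ R, k ≫ r = prod.lift x y

/-- The generalised elements `x` and `y` of `A` are locally related by the composite of
`r` and `s`. -/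
def CompHolds {R S X : C} (r : R ⟶ A ⨯ A) (s : S ⟶ A ⨯ A) (x y : X ⟶ A) : Prop :=
  ∃ (X' : C) (e : X' ⟶ X) (z : X' ⟶ A), StrongEpi e ∧
    RelHolds r (e ≫ x) z ∧ RelHolds s z (e ≫ y)

theorem RelHolds.precomp {R X X' : C} {r : R ⟶ A ⨯ A} {x y : X ⟶ A} (h : RelHolds r x y)
    (e : X' ⟶ X) : RelHolds r (e ≫ x) (e ≫ y) := by
  obtain ⟨k, hk⟩ := h
  exact ⟨e ≫ k, by rw [Category.assoc, hk, prod.comp_lift]⟩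

theorem RelHolds.of_strongEpi {R X X' : C} {r : R ⟶ A ⨯ A} [Mono r] {x y : X ⟶ A} (e : X' ⟶ X)
    [StrongEpi e] (h : RelHolds r (e ≫ x) (e ≫ y)) : RelHolds r x y := by
  obtain ⟨k, hk⟩ := h
  exact exists_factor_of_strongEpi e r _ k (by rw [hk, prod.comp_lift])

theorem relHolds_comp_legs {R X : C} (r : R ⟶ A ⨯ A) (k : X ⟶ R) :
    RelHolds r (k ≫ r ≫ prod.fst) (k ≫ r ≫ prod.snd) :=
  ⟨k, by ext <;> simp⟩

theorem relHolds_iff_factors (R : Subobject (A ⨯ A)) {X : C} (x y : X ⟶ A) :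
    RelHolds R.arrow x y ↔ R.Factors (prod.lift x y) := by
  constructor
  · rintro ⟨k, hk⟩
    exact hk ▸ Subobject.factors_comp_arrow k
  · exact fun h ↦ ⟨R.factorThru _ h, R.factorThru_arrow _ h⟩

theorem relHolds_mk_arrow {T X : C} (t : T ⟶ A ⨯ A) [Mono t] (x y : X ⟶ A) :
    RelHolds (Subobject.mk t).arrow x y ↔ RelHolds t x y := by
  rw [relHolds_iff_factors]
  exact Iff.rfl

theorem relHolds_of_le {R S : Subobject (A ⨯ A)} (h : R ≤ S) {X : C} {x y : X ⟶ A}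
    (hxy : RelHolds R.arrow x y) : RelHolds S.arrow x y := by
  rw [relHolds_iff_factors] at *
  exact Subobject.factors_of_le _ h hxy

theorem le_of_relHolds {R S : Subobject (A ⨯ A)}
    (h : ∀ (X : C) (x y : X ⟶ A), RelHolds R.arrow x y → RelHolds S.arrow x y) : R ≤ S := by
  refine Subobject.le_of_factors ?_
  have := h _ _ _ (relHolds_comp_legs R.arrow (𝟙 _))
  rw [relHolds_iff_factors] at this
  convert this using 1
  ext <;> simp

/-- A relation is an equivalence relation if it is one on generalised elements. -/
theorem isEquivRel_of_relHolds (R : Subobject (A ⨯ A))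
    (refl : ∀ (X : C) (x : X ⟶ A), RelHolds R.arrow x x)
    (symm : ∀ (X : C) (x y : X ⟶ A), RelHolds R.arrow x y → RelHolds R.arrow y x)
    (trans : ∀ (X : C) (x y z : X ⟶ A),
      RelHolds R.arrow x y → RelHolds R.arrow y z → RelHolds R.arrow x z) :
    IsEquivRel R := by
  refine ⟨refl _ (𝟙 A), ?_, ?_⟩
  · obtain ⟨k, hk⟩ := symm _ _ _ (relHolds_comp_legs R.arrow (𝟙 _))
    exact ⟨k, by simpa using hk⟩
  · refine trans _ _ (pullback.snd _ _ ≫ R.arrow ≫ prod.fst) _ ?_ (relHolds_comp_legs R.arrow _)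
    rw [← pullback.condition]
    exact relHolds_comp_legs R.arrow _

/-- The universal property of `relCompDom r s`, with `relCompMap r s` expressed through it. -/
theorem exists_relCompDom_legs {R S : C} (r : R ⟶ A ⨯ A) (s : S ⟶ A ⨯ A) :
    ∃ (a : relCompDom r s ⟶ R) (b : relCompDom r s ⟶ S),
      a ≫ r ≫ prod.snd = b ≫ s ≫ prod.fst ∧
      relCompMap r s = prod.lift (a ≫ r ≫ prod.fst) (b ≫ s ≫ prod.snd) ∧
      ∀ {X : C} (p : X ⟶ R) (q : X ⟶ S), p ≫ r ≫ prod.snd = q ≫ s ≫ prod.fst →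
        ∃ k, k ≫ a = p ∧ k ≫ b = q := by
  unfold relCompMap relCompDom
  refine ⟨equalizer.ι _ _ ≫ prod.fst, equalizer.ι _ _ ≫ prod.snd, ?_, ?_, fun p q hpq ↦ ?_⟩
  · simpa only [Category.assoc] using equalizer.condition
      ((prod.fst : R ⨯ S ⟶ R) ≫ r ≫ (prod.snd : A ⨯ A ⟶ A)) (prod.snd ≫ s ≫ prod.fst)
  · simp only [prod.comp_lift, Category.assoc]
  · exact ⟨equalizer.lift (prod.lift p q) (by simpa using hpq), by simp, by simp⟩

/-- On elements, `relCompMap r s` is the relational composite of `r` and `s`. -/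
theorem exists_relCompMap_iff {R S X : C} (r : R ⟶ A ⨯ A) (s : S ⟶ A ⨯ A) (x y : X ⟶ A) :
    (∃ k, k ≫ relCompMap r s = prod.lift x y) ↔ ∃ z, RelHolds r x z ∧ RelHolds s z y := by
  obtain ⟨a, b, hab, hmap, hlift⟩ := exists_relCompDom_legs r s
  rw [hmap]
  constructor
  · rintro ⟨k, hk⟩
    have hx : k ≫ a ≫ r ≫ prod.fst = x := by simpa using congr($hk ≫ prod.fst)
    have hy : k ≫ b ≫ s ≫ prod.snd = y := by simpa using congr($hk ≫ prod.snd)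
    refine ⟨k ≫ a ≫ r ≫ prod.snd, ?_, ?_⟩
    · rw [← hx]
      simpa using relHolds_comp_legs r (k ≫ a)
    · rw [← hy, hab]
      simpa using relHolds_comp_legs s (k ≫ b)
  · rintro ⟨z, ⟨p, hp⟩, ⟨q, hq⟩⟩
    obtain ⟨k, rfl, rfl⟩ := hlift p q (by simp [reassoc_of% hp, reassoc_of% hq])
    simp only [Category.assoc] at hp hq
    exact ⟨k, by ext <;> simp [reassoc_of% hp, reassoc_of% hq]⟩

theorem compHolds_of_strongEpi {R S X X' : C} {r : R ⟶ A ⨯ A} {s : S ⟶ A ⨯ A} {x y : X ⟶ A}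
    (e : X' ⟶ X) [StrongEpi e] (h : CompHolds r s (e ≫ x) (e ≫ y)) : CompHolds r s x y := by
  obtain ⟨X'', e', z, he', h₁, h₂⟩ := h
  exact ⟨X'', e' ≫ e, z, inferInstance, by simpa using h₁, by simpa using h₂⟩

theorem relHolds_iff_compHolds [RegularCat C] {R S T X : C} {r : R ⟶ A ⨯ A} {s : S ⟶ A ⨯ A}
    {t : T ⟶ A ⨯ A} [Mono t] (h : IsRelComp r s t) (x y : X ⟶ A) :
    RelHolds t x y ↔ CompHolds r s x y := by
  obtain ⟨e, he, het⟩ := h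
  have := strongEpi_of_regularEpi he
  constructor
  · rintro ⟨k, hk⟩
    obtain ⟨X', e', k', he', hk'⟩ := exists_local_lift e k
    obtain ⟨z, hz⟩ := (exists_relCompMap_iff r s (e' ≫ x) (e' ≫ y)).1
      ⟨k', by rw [← het, reassoc_of% hk', hk, prod.comp_lift]⟩
    exact ⟨X', e', z, he', hz⟩
  · rintro ⟨X', e', z, he', hz⟩
    obtain ⟨k, hk⟩ := (exists_relCompMap_iff r s _ _).2 ⟨z, hz⟩
    exact .of_strongEpi e' ⟨k ≫ e, by rw [Category.assoc, het, hk]⟩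

theorem commuteER_iff [RegularCat C] (θ₁ θ₂ : EquivOn A) :
    CommuteER θ₁ θ₂ ↔ ∀ (X : C) (x y : X ⟶ A),
      CompHolds θ₁.1.arrow θ₂.1.arrow x y ↔ CompHolds θ₂.1.arrow θ₁.1.arrow x y := by
  constructor
  · rintro ⟨T, t, _, h₁, h₂⟩ X x y
    rw [← relHolds_iff_compHolds h₁, relHolds_iff_compHolds h₂]
  · intro h
    obtain ⟨T, e, t, he, _, het⟩ := RegularCat.factor (relCompMap θ₁.1.arrow θ₂.1.arrow)
    obtain ⟨T', e', t', he', _, het'⟩ := RegularCat.factor (relCompMap θ₂.1.arrow θ₁.1.arrow)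
    have h₁ : IsRelComp θ₁.1.arrow θ₂.1.arrow t := ⟨e, he, het⟩
    have h₂ : IsRelComp θ₂.1.arrow θ₁.1.arrow t' := ⟨e', he', het'⟩
    have key (X : C) (x y : X ⟶ A) : RelHolds t x y ↔ RelHolds t' x y := by
      rw [relHolds_iff_compHolds h₁, relHolds_iff_compHolds h₂, h]
    have eta {V : C} (v : V ⟶ A ⨯ A) : prod.lift (v ≫ prod.fst) (v ≫ prod.snd) = v := by
      ext <;> simp
    obtain ⟨a, ha⟩ := (key _ _ _).1 ⟨𝟙 T, (Category.id_comp t).trans (eta t).symm⟩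
    obtain ⟨b, hb⟩ := (key _ _ _).2 ⟨𝟙 T', (Category.id_comp t').trans (eta t').symm⟩
    rw [eta] at ha hb
    have hab : b ≫ a = 𝟙 T' := by rw [← cancel_mono t', Category.assoc, ha, hb, Category.id_comp]
    have hba : a ≫ b = 𝟙 T := by rw [← cancel_mono t, Category.assoc, hb, ha, Category.id_comp]
    have : IsIso b := ⟨a, hab, hba⟩
    have := strongEpi_of_regularEpi he'
    exact ⟨T, t, ‹_›, h₁, e' ≫ b, regularEpi_of_strongEpi _, by rw [Category.assoc, hb, het']⟩

end Elements

section Exact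

variable [HasFiniteColimits C] {A : C}

instance (θ : EquivOn A) : IsRegularEpi (quotProj θ) :=
  inferInstanceAs (IsRegularEpi (coequalizer.π _ _))

/-- In an exact category, elements are related by `θ` iff they agree in `A/θ`. -/
theorem relHolds_iff_quotProj [BarrExact C] (θ : EquivOn A) {X : C} (x y : X ⟶ A) :
    RelHolds θ.1.arrow x y ↔ x ≫ quotProj θ = y ≫ quotProj θ := by
  have cond : (θ.1.arrow ≫ prod.fst) ≫ quotProj θ = (θ.1.arrow ≫ prod.snd) ≫ quotProj θ :=
    coequalizer.condition _ _
  constructor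
  · rintro ⟨k, hk⟩
    simpa [reassoc_of% hk] using congr(k ≫ $cond)
  · intro hxy
    obtain ⟨B, h, ⟨u, hu⟩, v, hv⟩ := BarrExact.effective A θ.1 θ.2
    have hh : (θ.1.arrow ≫ prod.fst) ≫ h = (θ.1.arrow ≫ prod.snd) ≫ h := by
      simp [← hu, kerPairMap, pullback.condition]
    obtain ⟨d, hd⟩ : ∃ d : quotER θ ⟶ B, quotProj θ ≫ d = h :=
      ⟨coequalizer.desc h hh, coequalizer.π_desc _ _⟩
    have hxy' : x ≫ h = y ≫ h := by rw [← hd, reassoc_of% hxy]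
    refine ⟨pullback.lift x y hxy' ≫ v, ?_⟩
    rw [Category.assoc, hv]
    ext <;> simp [kerPairMap, pullback.lift_fst, pullback.lift_snd]

variable [BarrExact C] {θ₁ θ₂ m j : EquivOn A}

theorem compHolds_comm (θ₁ θ₂ : EquivOn A) {X : C} (x y : X ⟶ A) :
    CompHolds θ₁.1.arrow θ₂.1.arrow x y ↔ CompHolds θ₂.1.arrow θ₁.1.arrow y x := by
  constructor <;>
  · rintro ⟨X', e, z, he, h₁, h₂⟩
    refine ⟨X', e, z, he, ?_, ?_⟩ <;> rw [relHolds_iff_quotProj] at *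
    exacts [h₂.symm, h₁.symm]

/-- Meets in `Equiv(A)` are computed as intersections. -/
theorem relHolds_of_isGLB (hm : IsGLB {θ₁, θ₂} m) {X : C} {x y : X ⟶ A}
    (h₁ : RelHolds θ₁.1.arrow x y) (h₂ : RelHolds θ₂.1.arrow x y) : RelHolds m.1.arrow x y := by
  have key (X : C) (x y : X ⟶ A) : RelHolds (θ₁.1 ⊓ θ₂.1).arrow x y ↔
      x ≫ quotProj θ₁ = y ≫ quotProj θ₁ ∧ x ≫ quotProj θ₂ = y ≫ quotProj θ₂ := by
    rw [relHolds_iff_factors, Subobject.inf_factors, ← relHolds_iff_factors,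
      ← relHolds_iff_factors, relHolds_iff_quotProj, relHolds_iff_quotProj]
  have hn : IsEquivRel (θ₁.1 ⊓ θ₂.1) := by
    refine isEquivRel_of_relHolds _ ?_ ?_ ?_ <;> simp only [key] <;> grind
  have hle : (⟨θ₁.1 ⊓ θ₂.1, hn⟩ : EquivOn A) ≤ m := by
    refine hm.2 ?_
    rintro θ (rfl | rfl)
    exacts [inf_le_left (a := θ.1), inf_le_right (b := θ.1)]
  refine relHolds_of_le hle ((key _ _ _).2 ?_)
  rw [relHolds_iff_quotProj] at h₁ h₂
  exact ⟨h₁, h₂⟩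

/-- If `θ₁` and `θ₂` commute, their join is contained in their composite. -/
theorem compHolds_of_isLUB (hc : CommuteER θ₁ θ₂) (hj : IsLUB {θ₁, θ₂} j) {X : C} {x y : X ⟶ A}
    (h : RelHolds j.1.arrow x y) : CompHolds θ₁.1.arrow θ₂.1.arrow x y := by
  have comm := (commuteER_iff θ₁ θ₂).1 hc
  obtain ⟨T, t, _, ht, -⟩ := hc
  have key (X : C) (x y : X ⟶ A) : RelHolds (Subobject.mk t).arrow x y ↔
      CompHolds θ₁.1.arrow θ₂.1.arrow x y := by
    rw [relHolds_mk_arrow, relHolds_iff_compHolds ht]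
  have refl (θ : EquivOn A) (X : C) (x : X ⟶ A) : RelHolds θ.1.arrow x x := by
    rw [relHolds_iff_quotProj]
  have trans (θ : EquivOn A) (X : C) (x y z : X ⟶ A) (h : RelHolds θ.1.arrow x y)
      (h' : RelHolds θ.1.arrow y z) : RelHolds θ.1.arrow x z := by
    rw [relHolds_iff_quotProj] at *
    exact h.trans h'
  have hT : IsEquivRel (Subobject.mk t) := by
    refine isEquivRel_of_relHolds _ ?_ ?_ ?_ <;> simp only [key]
    · exact fun X x ↦ ⟨X, 𝟙 X, 𝟙 X ≫ x, inferInstance, refl _ _ _, refl _ _ _⟩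
    · exact fun X x y hxy ↦ (comm X y x).2 ((compHolds_comm θ₁ θ₂ x y).1 hxy)
    · rintro X x y z ⟨X₁, e₁, a, _, hxa, hay⟩ ⟨X₂, e₂, b, _, hyb, hbz⟩
      obtain ⟨X₃, e₃, e₃', _, h₃⟩ := exists_local_lift e₂ e₁
      have hyb' := hyb.precomp e₃'
      have hbz' := hbz.precomp e₃'
      simp only [← Category.assoc, h₃] at hyb' hbz'
      have hxa' := hxa.precomp e₃
      have hay' := hay.precomp e₃
      simp only [← Category.assoc] at hxa' hay'
      obtain ⟨X₄, e₄, c, _, hac, hcb⟩ := (comm X₃ (e₃ ≫ a) (e₃' ≫ b)).2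
        ⟨X₃, 𝟙 _, _, inferInstance, by simpa using hay', by simpa using hyb'⟩
      refine compHolds_of_strongEpi (e₃ ≫ e₁) ⟨X₄, e₄, c, inferInstance, ?_, ?_⟩
      · exact trans _ _ _ _ _ (hxa'.precomp e₄) hac
      · exact trans _ _ _ _ _ hcb (hbz'.precomp e₄)
  have hle : j ≤ (⟨Subobject.mk t, hT⟩ : EquivOn A) := by
    refine hj.2 ?_
    rintro θ (rfl | rfl)
    · exact le_of_relHolds fun X x y hxy ↦ (key _ _ _).2
        ⟨X, 𝟙 X, y, inferInstance, by simpa using hxy, by simpa using refl _ _ _⟩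
    · exact le_of_relHolds fun X x y hxy ↦ (key _ _ _).2
        ⟨X, 𝟙 X, x, inferInstance, by simpa using refl _ _ _, by simpa using hxy⟩
  exact (key _ _ _).1 (relHolds_of_le hle h)

/-- If the square of quotients is a pullback, the composite is the kernel pair of `A ⟶ A/j`. -/
theorem compHolds_iff_of_isPullback
    {u₁ : quotER m ⟶ quotER θ₁} (hu₁ : quotProj m ≫ u₁ = quotProj θ₁)
    {u₂ : quotER m ⟶ quotER θ₂} (hu₂ : quotProj m ≫ u₂ = quotProj θ₂)
    {v₁ : quotER θ₁ ⟶ quotER j} (hv₁ : quotProj θ₁ ≫ v₁ = quotProj j)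
    {v₂ : quotER θ₂ ⟶ quotER j} (hv₂ : quotProj θ₂ ≫ v₂ = quotProj j)
    (h : IsPullback u₁ u₂ v₁ v₂) {X : C} (x y : X ⟶ A) :
    CompHolds θ₁.1.arrow θ₂.1.arrow x y ↔ x ≫ quotProj j = y ≫ quotProj j := by
  constructor
  · rintro ⟨X', e, z, _, h₁, h₂⟩
    rw [relHolds_iff_quotProj] at h₁ h₂
    rw [← cancel_epi e]
    calc e ≫ x ≫ quotProj j = ((e ≫ x) ≫ quotProj θ₁) ≫ v₁ := by simp [hv₁]
      _ = (z ≫ quotProj θ₂) ≫ v₂ := by rw [h₁]; simp [hv₁, hv₂]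
      _ = e ≫ y ≫ quotProj j := by rw [h₂]; simp [hv₂]
  · intro hxy
    obtain ⟨X', e, z, _, hz⟩ := exists_local_lift (quotProj m)
      (h.lift (x ≫ quotProj θ₁) (y ≫ quotProj θ₂) (by simpa [hv₁, hv₂] using hxy))
    refine ⟨X', e, z, ‹_›, ?_, ?_⟩ <;> rw [relHolds_iff_quotProj]
    · rw [← hu₁, reassoc_of% hz, h.lift_fst, hu₁, Category.assoc]
    · rw [← hu₂, reassoc_of% hz, h.lift_snd, hu₂, Category.assoc]

theorem mono_lift_of_isGLB (hm : IsGLB {θ₁, θ₂} m)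
    {u₁ : quotER m ⟶ quotER θ₁} (hu₁ : quotProj m ≫ u₁ = quotProj θ₁)
    {u₂ : quotER m ⟶ quotER θ₂} (hu₂ : quotProj m ≫ u₂ = quotProj θ₂) :
    Mono (prod.lift u₁ u₂) := by
  refine ⟨fun {X} a b hab ↦ ?_⟩
  have h₁ : a ≫ u₁ = b ≫ u₁ := by simpa using congr($hab ≫ prod.fst)
  have h₂ : a ≫ u₂ = b ≫ u₂ := by simpa using congr($hab ≫ prod.snd)
  obtain ⟨X₁, e₁, x, _, hx⟩ := exists_local_lift (quotProj m) a
  obtain ⟨X₂, e₂, y, _, hy⟩ := exists_local_lift (quotProj m) (e₁ ≫ b)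
  rw [← cancel_epi e₁, ← cancel_epi e₂, ← hx, ← hy, ← Category.assoc, ← relHolds_iff_quotProj]
  apply relHolds_of_isGLB hm <;> rw [relHolds_iff_quotProj]
  · rw [← hu₁, Category.assoc, reassoc_of% hx, reassoc_of% hy, h₁]
  · rw [← hu₂, Category.assoc, reassoc_of% hx, reassoc_of% hy, h₂]

end Exact

theorem statement19 [HasFiniteColimits C] [BarrExact C] {A : C}
    (θ₁ θ₂ m j : EquivOn A)
    -- m = θ₁ ∧ θ₂ and j = θ₁ ∨ θ₂ in the lattice Equiv(A)
    (hm : IsGLB {θ₁, θ₂} m) (hj : IsLUB {θ₁, θ₂} j)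
    -- the canonical maps between the quotients
    (u₁ : quotER m ⟶ quotER θ₁) (hu₁ : quotProj m ≫ u₁ = quotProj θ₁)
    (u₂ : quotER m ⟶ quotER θ₂) (hu₂ : quotProj m ≫ u₂ = quotProj θ₂)
    (v₁ : quotER θ₁ ⟶ quotER j) (hv₁ : quotProj θ₁ ≫ v₁ = quotProj j)
    (v₂ : quotER θ₂ ⟶ quotER j) (hv₂ : quotProj θ₂ ≫ v₂ = quotProj j) :
    -- θ₁ and θ₂ commute iff the square of canonical maps is a pullback
    CommuteER θ₁ θ₂ ↔ IsPullback u₁ u₂ v₁ v₂ := by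
  constructor
  · intro hc
    have := mono_lift_of_isGLB hm hu₁ hu₂
    have comm : u₁ ≫ v₁ = u₂ ≫ v₂ := by
      rw [← cancel_epi (quotProj m), reassoc_of% hu₁, reassoc_of% hu₂, hv₁, hv₂]
    have exists_lift {X : C} (a : X ⟶ quotER θ₁) (b : X ⟶ quotER θ₂) (hab : a ≫ v₁ = b ≫ v₂) :
        ∃ l, l ≫ prod.lift u₁ u₂ = prod.lift a b := by
      obtain ⟨X₁, e₁, x, _, hx⟩ := exists_local_lift (quotProj θ₁) a
      obtain ⟨X₂, e₂, y, _, hy⟩ := exists_local_lift (quotProj θ₂) (e₁ ≫ b)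
      have hxy : (e₂ ≫ x) ≫ quotProj j = y ≫ quotProj j := by
        rw [← hv₁, Category.assoc, reassoc_of% hx, hab, hv₁, ← hv₂, reassoc_of% hy]
      rw [← relHolds_iff_quotProj] at hxy
      obtain ⟨X₃, e₃, z, _, hxz, hzy⟩ := compHolds_of_isLUB hc hj hxy
      rw [relHolds_iff_quotProj] at hxz hzy
      refine exists_factor_of_strongEpi (e₃ ≫ e₂ ≫ e₁) _ _ (z ≫ quotProj m) ?_
      ext
      · simp [hu₁, ← hxz, hx]
      · simp [hu₂, hzy, hy]
    refine ⟨⟨comm⟩, ⟨PullbackCone.IsLimit.mk comm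
      (fun s ↦ (exists_lift s.fst s.snd s.condition).choose) (fun s ↦ ?_) (fun s ↦ ?_)
      (fun s l h₁ h₂ ↦ ?_)⟩⟩
    · simpa using congr($((exists_lift s.fst s.snd s.condition).choose_spec) ≫ prod.fst)
    · simpa using congr($((exists_lift s.fst s.snd s.condition).choose_spec) ≫ prod.snd)
    · rw [← cancel_mono (prod.lift u₁ u₂), (exists_lift s.fst s.snd s.condition).choose_spec,
        prod.comp_lift, h₁, h₂]
  · intro h
    rw [commuteER_iff]
    intro X x y
    rw [compHolds_comm θ₂ θ₁, compHolds_iff_of_isPullback hu₁ hu₂ hv₁ hv₂ h,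
      compHolds_iff_of_isPullback hu₁ hu₂ hv₁ hv₂ h]
    exact eq_comm
end
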